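/- Let p ∈ [1,2). For each n, let X^{(n)} be distributed according to ν_p^n (or according to μ_p^n) and let Θ^{(n)} be distributed uniformly on the Euclidean unit sphere 𝕊_2^{n-1}, independent of X^{(n)}. Then the sequence W_n = n^{1/p−1/2} ⟨X^{(n)}, Θ^{(n)}⟩ satisfies a large deviation principle with speed n^{2p/(2+p)} and good rate function I(w) = ((2+p)/(2p)) |w|^{2p/(2+p)}; that is, for every Borel set A ⊆ ℝ, −inf_{w ∈ int(A)} I(w) ≤ liminf_{n→∞} n^{−2p/(2+p)} log ℙ(W_n ∈ A) ≤ limsup_{n→∞} n^{−2p/(2+p)} log ℙ(W_n ∈ A) ≤ −inf_{w ∈ cl(A)} I(w). -/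

import Mathlib

open MeasureTheory Set Filter
open scoped ENNReal NNReal Topology

/-- The `p`-norm on the Euclidean space `ℝ^n`. -/
noncomputable def pnorm {n : ℕ} (p : ℝ) (x : EuclideanSpace ℝ (Fin n)) : ℝ :=
  (∑ i, |x i| ^ p) ^ (1 / p)

/-- The unit ball `𝔹_p^n`. -/
def pBall (n : ℕ) (p : ℝ) : Set (EuclideanSpace ℝ (Fin n)) := {x | pnorm p x ≤ 1}

/-- The unit sphere `𝕊_p^{n-1}`. -/
def pSphere (n : ℕ) (p : ℝ) : Set (EuclideanSpace ℝ (Fin n)) := {x | pnorm p x = 1}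

/-- The cone `[0,1]A`. -/
def coneSet {n : ℕ} (A : Set (EuclideanSpace ℝ (Fin n))) : Set (EuclideanSpace ℝ (Fin n)) :=
  Set.image2 (· • ·) (Icc (0 : ℝ) 1) A

/-- The uniform probability measure `ν_p^n` on `𝔹_p^n`. -/
noncomputable def nuMeasure (n : ℕ) (p : ℝ) : Measure (EuclideanSpace ℝ (Fin n)) :=
  (volume (pBall n p))⁻¹ • volume.restrict (pBall n p)

/-- `μ` is the cone probability measure `μ_p^n` on `𝕊_p^{n-1}`. -/
def IsConeMeasure (n : ℕ) (p : ℝ) (μ : Measure (EuclideanSpace ℝ (Fin n))) : Prop :=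
  (∀ A : Set (EuclideanSpace ℝ (Fin n)), MeasurableSet A → A ⊆ pSphere n p →
    μ A = volume (coneSet A) / volume (pBall n p)) ∧ μ (pSphere n p)ᶜ = 0

/-- The uniform (normalized surface, i.e. rotation-invariant) probability measure on the
Euclidean unit sphere `𝕊_2^{n-1}`, given by the normalized `(n−1)`-dimensional
Hausdorff measure. -/
noncomputable def sphereUniform (n : ℕ) : Measure (EuclideanSpace ℝ (Fin n)) :=
  (μH[(n : ℝ) - 1] (Metric.sphere (0 : EuclideanSpace ℝ (Fin n)) 1))⁻¹ •
    (μH[(n : ℝ) - 1]).restrict (Metric.sphere (0 : EuclideanSpace ℝ (Fin n)) 1)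

/-- A sequence of distributions `μ_n` on `ℝ` satisfies a large deviation principle with
speed `s(n)` and good rate function `I` if `I` has compact sublevel sets and for every
Borel set `A`,
`−inf_{int A} I ≤ liminf s(n)⁻¹ log μ_n(A) ≤ limsup s(n)⁻¹ log μ_n(A) ≤ −inf_{cl A} I`. -/
def IsLDP (μ : ℕ → Measure ℝ) (s : ℕ → ℝ) (I : ℝ → ℝ≥0∞) : Prop :=
  (∀ c : ℝ≥0, IsCompact {x : ℝ | I x ≤ (c : ℝ≥0∞)}) ∧
  ∀ A : Set ℝ, MeasurableSet A →
    (-(((⨅ x ∈ interior A, I x) : ℝ≥0∞) : EReal) ≤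
        liminf (fun n => (((s n)⁻¹ : ℝ) : EReal) * ENNReal.log (μ n A)) atTop ∧
      limsup (fun n => (((s n)⁻¹ : ℝ) : EReal) * ENNReal.log (μ n A)) atTop ≤
        -(((⨅ x ∈ closure A, I x) : ℝ≥0∞) : EReal))


/-- `f n` is at most `exp (-κ n ^ r)` for large `n`, for every `κ < κ₀`. -/
def ExpDecay (r κ₀ : ℝ) (f : ℕ → ℝ≥0∞) : Prop :=
  ∀ κ < κ₀, ∀ᶠ n : ℕ in atTop, f n ≤ ENNReal.ofReal (Real.exp (-(κ * (n : ℝ) ^ r)))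

theorem tendsto_natCast_rpow {r : ℝ} (hr : 0 < r) :
    Tendsto (fun n : ℕ => (n : ℝ) ^ r) atTop atTop :=
  (tendsto_rpow_atTop hr).comp tendsto_natCast_atTop_atTop

theorem ExpDecay.of_eventually_le {r κ₀ κ₁ : ℝ} {f g : ℕ → ℝ≥0∞} (hf : ExpDecay r κ₁ f)
    (hκ : κ₀ ≤ κ₁) (hle : ∀ᶠ n in atTop, g n ≤ f n) : ExpDecay r κ₀ g := by
  intro κ h
  filter_upwards [hf κ (h.trans_le hκ), hle] with n h1 h2 using h2.trans h1

theorem ExpDecay.of_le_exp {r κ₀ : ℝ} {f : ℕ → ℝ≥0∞} {g : ℕ → ℝ}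
    (hg : Tendsto (fun n : ℕ => g n / (n : ℝ) ^ r) atTop (𝓝 0))
    (hf : ∀ᶠ n : ℕ in atTop, f n ≤ ENNReal.ofReal (Real.exp (-(κ₀ * (n : ℝ) ^ r) + g n))) :
    ExpDecay r κ₀ f := by
  intro κ hκ
  have h1 : ∀ᶠ n : ℕ in atTop, g n / (n : ℝ) ^ r < κ₀ - κ :=
    hg.eventually_lt_const (by linarith)
  filter_upwards [hf, h1, eventually_gt_atTop 0] with n h2 h3 h4
  refine h2.trans (ENNReal.ofReal_le_ofReal (Real.exp_le_exp.2 ?_))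
  have h5 : 0 < (n : ℝ) ^ r := Real.rpow_pos_of_pos (by exact_mod_cast h4) _
  rw [div_lt_iff₀ h5] at h3
  linarith

theorem ExpDecay.add {r κ₀ : ℝ} (hr : 0 < r) {f g : ℕ → ℝ≥0∞} (hf : ExpDecay r κ₀ f)
    (hg : ExpDecay r κ₀ g) : ExpDecay r κ₀ (fun n => f n + g n) := by
  intro κ hκ
  obtain ⟨κ', h1, h2⟩ := exists_between hκ
  have h3 : ∀ᶠ n : ℕ in atTop, Real.log 2 / (κ' - κ) ≤ (n : ℝ) ^ r :=
    (tendsto_natCast_rpow hr).eventually_ge_atTop _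
  filter_upwards [hf κ' h2, hg κ' h2, h3] with n hf hg h3
  refine (add_le_add hf hg).trans ?_
  rw [← ENNReal.ofReal_add (by positivity) (by positivity)]
  refine ENNReal.ofReal_le_ofReal ?_
  rw [div_le_iff₀ (by linarith)] at h3
  have : Real.exp (-(κ * (n : ℝ) ^ r)) =
      Real.exp ((n : ℝ) ^ r * (κ' - κ)) * Real.exp (-(κ' * (n : ℝ) ^ r)) := by
    rw [← Real.exp_add]; ring_nf
  have h4 : (2 : ℝ) ≤ Real.exp ((n : ℝ) ^ r * (κ' - κ)) := by
    rw [← Real.log_le_iff_le_exp (by norm_num)]; exact h3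
  rw [this, ← two_mul]
  gcongr

theorem exp_le_one_add_add_sq_mul (x : ℝ) :
    Real.exp x ≤ 1 + x + x ^ 2 * Real.exp (max x 0) := by
  rcases le_total x 0 with hx | hx
  · rw [max_eq_right hx, Real.exp_zero, mul_one]
    have h1 : 1 - x ≤ Real.exp (-x) := by linarith [Real.add_one_le_exp (-x)]
    rw [Real.exp_neg] at h1
    have h2 : Real.exp x ≤ (1 - x)⁻¹ := by
      rw [le_inv_comm₀ (Real.exp_pos x) (by linarith)]; exact h1
    refine h2.trans ?_
    rw [inv_le_iff_one_le_mul₀ (by linarith)]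
    nlinarith [mul_nonneg (sq_nonneg x) (neg_nonneg.2 hx)]
  · rw [max_eq_left hx]
    have h1 : 1 - x ≤ Real.exp (-x) := by linarith [Real.add_one_le_exp (-x)]
    rw [Real.exp_neg] at h1
    have h2 : (1 - x) * Real.exp x ≤ 1 := by
      rwa [← le_mul_inv_iff₀ (Real.exp_pos x), one_mul]
    nlinarith [mul_le_mul_of_nonneg_left h2 (by linarith : 0 ≤ 1 + x)]

section HeavyTail

variable {Ω : Type*} [MeasurableSpace Ω] {ρ : Measure Ω} [IsProbabilityMeasure ρ]

theorem pi_exists_lt_le {f : Ω → ℝ} (hf : Measurable f) (n : ℕ) (M : ℝ) :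
    Measure.pi (fun _ : Fin n => ρ) {x | ∃ i, M < f (x i)} ≤ n * ρ {x | M < f x} := by
  have h : {x : Fin n → Ω | ∃ i, M < f (x i)} = ⋃ i : Fin n, Function.eval i ⁻¹' {x | M < f x} := by
    ext x; simp
  rw [h]
  refine (measure_iUnion_fintype_le _ _).trans ?_
  have : ∀ i : Fin n, Measure.pi (fun _ : Fin n => ρ) (Function.eval i ⁻¹' {x | M < f x})
      = ρ {x | M < f x} := fun i =>
    (measurePreserving_eval (fun _ : Fin n => ρ) i).measure_preimage
      (measurableSet_lt measurable_const hf).nullMeasurableSet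
  simp only [this, Finset.sum_const, Finset.card_univ, Fintype.card_fin, nsmul_eq_mul, le_refl]

theorem pi_sum_ge_le_exp_mul_pow {g : Ω → ℝ} (n : ℕ) {t c : ℝ} (ht : 0 ≤ t)
    (hint : Integrable (fun x => Real.exp (t * g x)) ρ) (hc : ∫ x, Real.exp (t * g x) ∂ρ ≤ c)
    (M : ℝ) :
    Measure.pi (fun _ : Fin n => ρ) {x | M ≤ ∑ i, g (x i)} ≤
      ENNReal.ofReal (Real.exp (-t * M) * c ^ n) := by
  have hprod : (fun x : Fin n → Ω => Real.exp (t * ∑ i, g (x i))) =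
      fun x => ∏ i, Real.exp (t * g (x i)) := by
    ext x; rw [Finset.mul_sum, Real.exp_sum]
  have h := ProbabilityTheory.measure_ge_le_exp_mul_mgf (μ := Measure.pi (fun _ : Fin n => ρ))
    (X := fun x => ∑ i, g (x i)) M ht (by
      rw [hprod]
      exact Integrable.fintype_prod (f := fun _ x => Real.exp (t * g x)) fun _ => hint)
  rw [← ofReal_measureReal]
  refine ENNReal.ofReal_le_ofReal (h.trans ?_)
  gcongr
  rw [ProbabilityTheory.mgf, hprod,
    integral_fintype_prod_eq_prod (μ := fun _ => ρ) (fun _ x => Real.exp (t * g x))]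
  simp only [Finset.prod_const, Finset.card_univ, Fintype.card_fin]
  exact pow_le_pow_left₀ (integral_nonneg fun _ => (Real.exp_pos _).le) hc n

theorem integral_exp_truncation_le {f : Ω → ℝ} (hf : Measurable f) (hint : Integrable f ρ)
    (hmean : ∫ x, f x ∂ρ = 0) {r b M t : ℝ} (hr0 : 0 < r) (hr1 : r < 1) (hb : 0 < b) (hM : 0 < M)
    (ht : t = b * M ^ (r - 1))
    (hI : Integrable (fun x => f x ^ 2 * Real.exp (b * max (f x) 0 ^ r)) ρ) :
    Integrable (fun x => Real.exp (t * (if f x ≤ M then f x else 0))) ρ ∧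
    ∫ x, Real.exp (t * (if f x ≤ M then f x else 0)) ∂ρ ≤
      Real.exp (t ^ 2 * ∫ x, f x ^ 2 * Real.exp (b * max (f x) 0 ^ r) ∂ρ) := by
  set g : Ω → ℝ := fun x => if f x ≤ M then f x else 0 with hg
  have hms : MeasurableSet {x | f x ≤ M} := measurableSet_le hf measurable_const
  have hgm : Measurable g := Measurable.ite hms hf measurable_const
  have ht0 : 0 < t := by rw [ht]; positivity
  have hgint : Integrable g ρ := by
    refine hint.mono hgm.aestronglyMeasurable (ae_of_all _ fun x => ?_)
    simp only [hg]; split_ifs <;> simp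
  have hgf : ∀ x, g x ≤ f x := by
    intro x; simp only [hg]; split_ifs with h
    · exact le_rfl
    · linarith [not_le.1 h]
  have hgM : ∀ x, g x ≤ M := by
    intro x; simp only [hg]; split_ifs with h
    · exact h
    · exact hM.le
  have hg2 : ∀ x, g x ^ 2 ≤ f x ^ 2 := by
    intro x; simp only [hg]; split_ifs with h
    · exact le_rfl
    · simp; positivity
  have hkey : ∀ x, t * g x ≤ b * max (f x) 0 ^ r := by
    intro x
    rcases le_or_gt (g x) 0 with h | h
    · exact (mul_nonpos_of_nonneg_of_nonpos ht0.le h).trans (by positivity)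
    · have h1 : t * g x ≤ b * g x ^ r := by
        rw [ht, mul_assoc]
        refine mul_le_mul_of_nonneg_left ?_ hb.le
        have : M ^ (r - 1) ≤ g x ^ (r - 1) :=
          Real.rpow_le_rpow_of_nonpos h (hgM x) (by linarith)
        calc M ^ (r - 1) * g x ≤ g x ^ (r - 1) * g x := by gcongr
          _ = g x ^ r := by
            rw [← Real.rpow_add_one h.ne']; ring_nf
      refine h1.trans ?_
      have : g x ≤ max (f x) 0 := (hgf x).trans (le_max_left _ _)
      gcongr
  have hbound : ∀ x, Real.exp (t * g x) ≤
      1 + t * g x + t ^ 2 * (f x ^ 2 * Real.exp (b * max (f x) 0 ^ r)) := by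
    intro x
    refine (exp_le_one_add_add_sq_mul _).trans ?_
    rw [mul_pow, mul_assoc]
    have h1 : max (t * g x) 0 ≤ b * max (f x) 0 ^ r := max_le (hkey x) (by positivity)
    exact add_le_add le_rfl (mul_le_mul_of_nonneg_left (mul_le_mul (hg2 x)
      (Real.exp_le_exp.2 h1) (Real.exp_pos _).le (sq_nonneg _)) (sq_nonneg _))
  have hRint : Integrable (fun x => 1 + t * g x +
      t ^ 2 * (f x ^ 2 * Real.exp (b * max (f x) 0 ^ r))) ρ :=
    ((integrable_const _).add (hgint.const_mul _)).add (hI.const_mul _)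
  have hLint : Integrable (fun x => Real.exp (t * g x)) ρ := by
    refine hRint.mono' (by fun_prop) (ae_of_all _ fun x => ?_)
    rw [Real.norm_eq_abs, abs_of_pos (Real.exp_pos _)]
    exact hbound x
  refine ⟨hLint, (integral_mono hLint hRint hbound).trans ?_⟩
  have hsum : Integrable (fun x => 1 + t * g x) ρ :=
    (integrable_const _).add (hgint.const_mul _)
  rw [integral_add hsum (hI.const_mul _),
    integral_add (integrable_const _) (hgint.const_mul _), integral_const_mul, integral_const_mul]
  have h0 : ∫ x, g x ∂ρ ≤ 0 := hmean ▸ integral_mono hgint hint hgf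
  have h1 : t * ∫ x, g x ∂ρ ≤ 0 := mul_nonpos_of_nonneg_of_nonpos ht0.le h0
  have h2 := Real.add_one_le_exp
    (t ^ 2 * ∫ x, f x ^ 2 * Real.exp (b * max (f x) 0 ^ r) ∂ρ)
  simp only [integral_const, probReal_univ, smul_eq_mul, mul_one]
  linarith

theorem measure_gt_le_exp {f : Ω → ℝ} {r b M : ℝ} (hr0 : 0 < r) (hb : 0 < b) (hM : 1 ≤ M)
    (hI : Integrable (fun x => f x ^ 2 * Real.exp (b * max (f x) 0 ^ r)) ρ) :
    ρ {x | M < f x} ≤ ENNReal.ofReal (Real.exp (-(b * M ^ r)) *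
      ∫ x, f x ^ 2 * Real.exp (b * max (f x) 0 ^ r) ∂ρ) := by
  have h0 : 0 ≤ᵐ[ρ] fun x => f x ^ 2 * Real.exp (b * max (f x) 0 ^ r) :=
    ae_of_all _ fun x => by positivity
  have h := mul_meas_ge_le_integral_of_nonneg h0 hI (Real.exp (b * M ^ r))
  rw [← ofReal_measureReal]
  refine ENNReal.ofReal_le_ofReal ?_
  rw [Real.exp_neg, ← div_eq_inv_mul, le_div_iff₀ (Real.exp_pos _), mul_comm]
  refine le_trans ?_ h
  refine mul_le_mul_of_nonneg_left (measureReal_mono (μ := ρ) (fun x hx => ?_)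
    (measure_ne_top _ _)) (Real.exp_pos _).le
  have hx' : M < f x := hx
  have h1 : b * M ^ r ≤ b * max (f x) 0 ^ r := by
    have : M ≤ max (f x) 0 := hx'.le.trans (le_max_left _ _)
    gcongr
  have h2 : 1 ≤ f x ^ 2 := by nlinarith
  calc Real.exp (b * M ^ r) = 1 * Real.exp (b * M ^ r) := (one_mul _).symm
    _ ≤ _ := mul_le_mul h2 (Real.exp_le_exp.2 h1) (Real.exp_pos _).le (by positivity)

/-- Upper large deviation bound for sums of i.i.d. centred variables whose right tail is at most
stretched exponential with exponent `r < 1`. -/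
theorem expDecay_sum_ge {f : Ω → ℝ} (hf : Measurable f) (hint : Integrable f ρ)
    (hmean : ∫ x, f x ∂ρ = 0) {r b v : ℝ} (hr0 : 0 < r) (hr1 : r < 1) (hb : 0 < b) (hv : 0 < v)
    (hI : Integrable (fun x => f x ^ 2 * Real.exp (b * max (f x) 0 ^ r)) ρ) :
    ExpDecay r (b * v ^ r)
      (fun n => Measure.pi (fun _ : Fin n => ρ) {x | v * n ≤ ∑ i, f (x i)}) := by
  set K := ∫ x, f x ^ 2 * Real.exp (b * max (f x) 0 ^ r) ∂ρ with hK
  have hK0 : 0 ≤ K := integral_nonneg fun x => by positivity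
  have hrpow : ∀ n : ℕ, (v * n) ^ r = v ^ r * (n : ℝ) ^ r := fun n =>
    Real.mul_rpow hv.le n.cast_nonneg
  have hbig : ExpDecay r (b * v ^ r) (fun n : ℕ => (n : ℝ≥0∞) * ρ {x | v * n < f x}) := by
    refine ExpDecay.of_le_exp (g := fun n : ℕ => Real.log n + K) ?_ ?_
    · have h1 : Tendsto (fun n : ℕ => Real.log n / (n : ℝ) ^ r) atTop (𝓝 0) :=
        ((isLittleO_log_rpow_atTop hr0).tendsto_div_nhds_zero).comp tendsto_natCast_atTop_atTop
      have h2 : Tendsto (fun n : ℕ => K / (n : ℝ) ^ r) atTop (𝓝 0) :=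
        (tendsto_natCast_rpow hr0).const_div_atTop K
      simpa [add_div] using h1.add h2
    · filter_upwards [eventually_ge_atTop ⌈1 / v⌉₊, eventually_gt_atTop 0] with n hn hn0
      have hM : 1 ≤ v * n := by
        have := Nat.ceil_le.1 hn
        rw [div_le_iff₀ hv] at this
        linarith
      have hn0' : (0 : ℝ) < n := by exact_mod_cast hn0
      refine (mul_le_mul_right (measure_gt_le_exp hr0 hb hM hI) _).trans ?_
      rw [← hK, ← ENNReal.ofReal_natCast, ← ENNReal.ofReal_mul hn0'.le]
      refine ENNReal.ofReal_le_ofReal ?_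
      rw [hrpow, Real.exp_add, Real.exp_add, Real.exp_log hn0', mul_assoc b]
      have := Real.add_one_le_exp K
      calc (n : ℝ) * (Real.exp (-(b * (v ^ r * (n : ℝ) ^ r))) * K)
          = Real.exp (-(b * (v ^ r * (n : ℝ) ^ r))) * (n * K) := by ring
        _ ≤ _ := by gcongr; linarith
  have hsmall : ExpDecay r (b * v ^ r) (fun n : ℕ => Measure.pi (fun _ : Fin n => ρ)
      {x | v * n ≤ ∑ i, if f (x i) ≤ v * n then f (x i) else 0}) := by
    refine ExpDecay.of_le_exp (g := fun n : ℕ => n * ((b * (v * n) ^ (r - 1)) ^ 2 * K)) ?_ ?_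
    · have h1 : Tendsto (fun n : ℕ => (b * v ^ (r - 1)) ^ 2 * K * ((n : ℝ) ^ (1 - r))⁻¹) atTop
          (𝓝 ((b * v ^ (r - 1)) ^ 2 * K * 0)) :=
        ((tendsto_natCast_rpow (by linarith)).inv_tendsto_atTop).const_mul _
      rw [mul_zero] at h1
      refine h1.congr' ?_
      filter_upwards [eventually_gt_atTop 0] with n hn0
      have hn0' : (0 : ℝ) < n := by exact_mod_cast hn0
      rw [Real.mul_rpow hv.le hn0'.le, eq_div_iff (by positivity)]
      have e1 : (n : ℝ) ^ (r - 1) = ((n : ℝ) ^ (1 - r))⁻¹ := by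
        rw [← Real.rpow_neg hn0'.le]; ring_nf
      have e2 : (n : ℝ) = (n : ℝ) ^ r * (n : ℝ) ^ (1 - r) := by
        rw [← Real.rpow_add hn0']; simp
      have e3 : (0 : ℝ) < (n : ℝ) ^ (1 - r) := by positivity
      rw [e1]
      generalize (n : ℝ) ^ (1 - r) = u at *
      generalize (n : ℝ) ^ r = y at *
      rw [e2]
      field_simp
    · filter_upwards [eventually_gt_atTop 0] with n hn0
      have hn0' : (0 : ℝ) < n := by exact_mod_cast hn0
      have hM : 0 < v * n := by positivity
      obtain ⟨hi, hle⟩ := integral_exp_truncation_le hf hint hmean hr0 hr1 hb hM rfl hI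
      refine (pi_sum_ge_le_exp_mul_pow n (by positivity) hi hle (v * n)).trans
        (ENNReal.ofReal_le_ofReal (le_of_eq ?_))
      rw [← Real.exp_nat_mul, ← Real.exp_add]
      congr 1
      have : (v * (n : ℝ)) ^ (r - 1) * (v * n) = v ^ r * (n : ℝ) ^ r := by
        rw [← Real.rpow_add_one hM.ne', sub_add_cancel, hrpow]
      rw [neg_mul, mul_assoc b, this, mul_assoc b]
  refine (hbig.add hr0 hsmall).of_eventually_le le_rfl (Eventually.of_forall fun n => ?_)
  refine le_trans (measure_mono ?_) ((measure_union_le _ _).trans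
    (add_le_add_left (pi_exists_lt_le hf n (v * n)) _))
  intro x hx
  by_cases h : ∃ i, v * n < f (x i)
  · exact Or.inl h
  · right
    push Not at h
    simp only [mem_ofPred_eq, h, if_true]
    exact hx

theorem tendsto_pi_abs_sum_sub_ge {f : Ω → ℝ} (hf : MemLp f 2 ρ) {a ε : ℝ}
    (ha : ∫ x, f x ∂ρ = a) (hε : 0 < ε) :
    Tendsto (fun n : ℕ => Measure.pi (fun _ : Fin n => ρ)
      {x | ε * n ≤ |∑ i, f (x i) - n * a|}) atTop (𝓝 0) := by
  have hbound : ∀ᶠ n : ℕ in atTop, Measure.pi (fun _ : Fin n => ρ)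
      {x | ε * n ≤ |∑ i, f (x i) - n * a|} ≤
      ENNReal.ofReal (ProbabilityTheory.variance f ρ / ε ^ 2 * ((n : ℝ))⁻¹) := by
    filter_upwards [eventually_gt_atTop 0] with n hn0
    have hn0' : (0 : ℝ) < n := by exact_mod_cast hn0
    have hL : ∀ i : Fin n, MemLp (fun x : Fin n → Ω => f (x i)) 2 (Measure.pi fun _ => ρ) :=
      fun i => hf.comp_measurePreserving (measurePreserving_eval (fun _ : Fin n => ρ) i)
    have hmean : ∫ x, ∑ i, f (x i) ∂(Measure.pi fun _ : Fin n => ρ) = n * a := by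
      rw [integral_finsetSum _ fun i _ => (hL i).integrable one_le_two]
      have : ∀ i : Fin n, ∫ x, f (x i) ∂(Measure.pi fun _ : Fin n => ρ) = a := by
        intro i
        rw [← ha]
        exact integral_comp_eval (μ := fun _ : Fin n => ρ) hf.aestronglyMeasurable
      simp [this]
    have hL' : MemLp (fun x : Fin n → Ω => ∑ i, f (x i)) 2 (Measure.pi fun _ => ρ) :=
      memLp_finsetSum _ fun i _ => hL i
    have h := ProbabilityTheory.meas_ge_le_variance_div_sq hL' (c := ε * n) (by positivity)
    rw [hmean] at h
    refine h.trans (ENNReal.ofReal_le_ofReal (le_of_eq ?_))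
    have := ProbabilityTheory.variance_sum_pi (μ := fun _ : Fin n => ρ) (X := fun _ => f)
      (fun _ => hf)
    have e : (fun x : Fin n → Ω => ∑ i, f (x i)) = ∑ i, fun x : Fin n → Ω => f (x i) := by
      ext x; simp
    rw [e, this]
    simp
    field_simp
  refine tendsto_of_tendsto_of_tendsto_of_le_of_le' tendsto_const_nhds ?_
    (Eventually.of_forall fun _ => zero_le) hbound
  have h1 : Tendsto (fun n : ℕ => ProbabilityTheory.variance f ρ / ε ^ 2 * ((n : ℝ))⁻¹) atTop
      (𝓝 (ProbabilityTheory.variance f ρ / ε ^ 2 * 0)) :=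
    tendsto_inv_atTop_nhds_zero_nat.const_mul _
  rw [mul_zero] at h1
  simpa using ENNReal.tendsto_ofReal h1

end HeavyTail

/-- The probability law on `ℝ` with density proportional to `exp (-|x| ^ q / q)`. -/
noncomputable def expPowLaw (q : ℝ) : Measure ℝ :=
  (volume : Measure ℝ).tilted fun x => -(|x| ^ q / q)

theorem integral_abs_rpow_mul_exp_neg {q k b : ℝ} (hq : 0 < q) (hk : 0 ≤ k) (hb : 0 < b) :
    ∫ x : ℝ, |x| ^ k * Real.exp (-b * |x| ^ q) =
      2 * (b ^ (-(k + 1) / q) * (1 / q) * Real.Gamma ((k + 1) / q)) := by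
  rw [integral_comp_abs (f := fun x => x ^ k * Real.exp (-b * x ^ q)),
    integral_rpow_mul_exp_neg_mul_rpow hq (by linarith) hb]

theorem integrable_abs_rpow_mul_exp_neg {q k b : ℝ} (hq : 0 < q) (hk : 0 ≤ k) (hb : 0 < b) :
    Integrable fun x : ℝ => |x| ^ k * Real.exp (-b * |x| ^ q) := by
  refine Integrable.of_integral_ne_zero ?_
  rw [integral_abs_rpow_mul_exp_neg hq hk hb]
  have : 0 < Real.Gamma ((k + 1) / q) := Real.Gamma_pos_of_pos (by positivity)
  positivity

theorem exp_neg_div_eq (q x : ℝ) :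
    Real.exp (-(|x| ^ q / q)) = |x| ^ (0 : ℝ) * Real.exp (-(1 / q) * |x| ^ q) := by
  rw [Real.rpow_zero, one_mul]; congr 1; ring

theorem integrable_exp_neg_abs_rpow_div {q : ℝ} (hq : 0 < q) :
    Integrable fun x : ℝ => Real.exp (-(|x| ^ q / q)) := by
  simp_rw [exp_neg_div_eq]
  exact integrable_abs_rpow_mul_exp_neg hq le_rfl (by positivity)

theorem isProbabilityMeasure_expPowLaw {q : ℝ} (hq : 0 < q) :
    IsProbabilityMeasure (expPowLaw q) :=
  isProbabilityMeasure_tilted (integrable_exp_neg_abs_rpow_div hq)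

theorem integrable_expPowLaw_abs_rpow_mul_exp {q k a : ℝ} (hq : 0 < q) (hk : 0 ≤ k)
    (ha : a < 1 / q) :
    Integrable (fun x : ℝ => |x| ^ k * Real.exp (a * |x| ^ q)) (expPowLaw q) := by
  rw [expPowLaw, integrable_tilted_iff (integrable_exp_neg_abs_rpow_div hq)]
  refine (integrable_abs_rpow_mul_exp_neg hq hk (sub_pos.2 ha)).congr (ae_of_all _ fun x => ?_)
  simp only [smul_eq_mul]
  rw [mul_left_comm, ← Real.exp_add]
  ring_nf

theorem integrable_expPowLaw_abs_rpow {q k : ℝ} (hq : 0 < q) (hk : 0 ≤ k) :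
    Integrable (fun x : ℝ => |x| ^ k) (expPowLaw q) := by
  simpa using integrable_expPowLaw_abs_rpow_mul_exp hq hk (a := 0) (by positivity)

theorem integral_expPowLaw_abs_rpow {q : ℝ} (hq : 0 < q) :
    ∫ x : ℝ, |x| ^ q ∂(expPowLaw q) = 1 := by
  have h1 : ∫ x : ℝ, |x| ^ q * Real.exp (-(|x| ^ q / q)) = ∫ x : ℝ, Real.exp (-(|x| ^ q / q)) := by
    have : ∀ x : ℝ, |x| ^ q * Real.exp (-(|x| ^ q / q)) =
        |x| ^ q * Real.exp (-(1 / q) * |x| ^ q) := fun x => by congr 2; ring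
    simp_rw [this, exp_neg_div_eq]
    rw [integral_abs_rpow_mul_exp_neg hq hq.le (by positivity),
      integral_abs_rpow_mul_exp_neg hq le_rfl (by positivity)]
    have e1 : (q + 1) / q = 1 / q + 1 := by field_simp; ring
    have e2 : -(q + 1) / q = -(0 + 1) / q - 1 := by field_simp; ring
    rw [e2, e1, Real.Gamma_add_one (by positivity), Real.rpow_sub_one (by positivity), zero_add]
    field_simp
  have h0 : 0 < ∫ x : ℝ, Real.exp (-(|x| ^ q / q)) :=
    integral_exp_pos (integrable_exp_neg_abs_rpow_div hq)
  rw [expPowLaw, integral_tilted]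
  simp only [smul_eq_mul]
  have : ∀ x : ℝ, Real.exp (-(|x| ^ q / q)) / (∫ x : ℝ, Real.exp (-(|x| ^ q / q))) * |x| ^ q =
      |x| ^ q * Real.exp (-(|x| ^ q / q)) * (∫ x : ℝ, Real.exp (-(|x| ^ q / q)))⁻¹ := by
    intro x; ring
  simp_rw [this]
  rw [integral_mul_const, h1, mul_inv_cancel₀ h0.ne']

theorem integral_expPowLaw_id (q : ℝ) : ∫ x : ℝ, x ∂(expPowLaw q) = 0 := by
  rw [expPowLaw, integral_tilted]
  have h := integral_neg_eq_self
    (fun x : ℝ => (Real.exp (-(|x| ^ q / q)) / ∫ x : ℝ, Real.exp (-(|x| ^ q / q))) • x) volume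
  simp only [abs_neg, smul_neg, integral_neg] at h
  linarith

theorem expPowLaw_interval_ge {q : ℝ} (hq : 0 < q) (a : ℝ) {ε : ℝ} (hε : 0 < ε) :
    ∃ C > 0, ∀ h : ℝ, 1 ≤ h →
      ENNReal.ofReal (C * Real.exp (-(((|a| + ε) ^ q / q) * h ^ q))) ≤
        expPowLaw q {x | |x - a * h| ≤ ε * h} := by
  set Z := ∫ x : ℝ, Real.exp (-(|x| ^ q / q)) with hZ
  have hZ0 : 0 < Z := integral_exp_pos (integrable_exp_neg_abs_rpow_div hq)
  refine ⟨2 * ε / Z, by positivity, fun h hh => ?_⟩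
  have hset : {x : ℝ | |x - a * h| ≤ ε * h} = Icc (a * h - ε * h) (a * h + ε * h) := by
    ext x
    simp only [mem_ofPred_eq, mem_Icc, abs_le]
    constructor <;> rintro ⟨h1, h2⟩ <;> constructor <;> linarith
  rw [hset, expPowLaw, tilted_apply' _ _ measurableSet_Icc, ← hZ]
  set c := Real.exp (-(((|a| + ε) ^ q / q) * h ^ q)) with hc
  have hle : ∀ x ∈ Icc (a * h - ε * h) (a * h + ε * h),
      ENNReal.ofReal (c / Z) ≤ ENNReal.ofReal (Real.exp (-(|x| ^ q / q)) / Z) := by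
    intro x hx
    refine ENNReal.ofReal_le_ofReal ?_
    gcongr
    refine Real.exp_le_exp.2 (neg_le_neg ?_)
    have h1 : |x| ≤ (|a| + ε) * h := by
      have h2 : |x - a * h| ≤ ε * h := by rw [abs_le]; constructor <;> linarith [hx.1, hx.2]
      have h3 : |x| ≤ |x - a * h| + |a * h| := by
        simpa using abs_add_le (x - a * h) (a * h)
      rw [abs_mul, abs_of_pos (by linarith : 0 < h)] at h3
      linarith
    calc |x| ^ q / q ≤ ((|a| + ε) * h) ^ q / q := by gcongr
      _ = _ := by rw [Real.mul_rpow (by positivity) (by linarith)]; ring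
  refine le_trans ?_ (setLIntegral_mono' measurableSet_Icc hle)
  rw [setLIntegral_const, Real.volume_Icc, ← ENNReal.ofReal_mul (by positivity)]
  refine ENNReal.ofReal_le_ofReal ?_
  calc 2 * ε / Z * c = c / Z * (2 * ε * 1) := by ring
    _ ≤ c / Z * (2 * ε * h) := by gcongr
    _ = _ := by ring

section PairLaw

/-- The joint law of a pair of independent variables with laws `expPowLaw p` and `expPowLaw 2`. -/
noncomputable def pairLaw (p : ℝ) : Measure (ℝ × ℝ) := (expPowLaw p).prod (expPowLaw 2)

variable {p : ℝ}

theorem isProbabilityMeasure_pairLaw (hp : 0 < p) : IsProbabilityMeasure (pairLaw p) := by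
  have := isProbabilityMeasure_expPowLaw hp
  have := isProbabilityMeasure_expPowLaw (q := 2) (by norm_num)
  exact inferInstanceAs (IsProbabilityMeasure ((expPowLaw p).prod (expPowLaw 2)))

theorem mul_abs_mul_rpow_le (hp : 0 < p) (y z : ℝ) :
    (2 + p) / (2 * p) * |y * z| ^ (2 * p / (2 + p)) ≤ |y| ^ p / p + |z| ^ (2 : ℝ) / 2 := by
  have h := Real.geom_mean_le_arith_mean2_weighted (w₁ := 2 / (2 + p)) (w₂ := p / (2 + p))
    (p₁ := |y| ^ p) (p₂ := |z| ^ (2 : ℝ)) (by positivity) (by positivity) (by positivity)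
    (by positivity) (by field_simp)
  rw [← Real.rpow_mul (abs_nonneg _), ← Real.rpow_mul (abs_nonneg _)] at h
  have e1 : p * (2 / (2 + p)) = 2 * p / (2 + p) := by ring
  have e2 : 2 * (p / (2 + p)) = 2 * p / (2 + p) := by ring
  rw [e1, e2, ← Real.mul_rpow (abs_nonneg _) (abs_nonneg _), ← abs_mul] at h
  calc _ ≤ (2 + p) / (2 * p) * (2 / (2 + p) * |y| ^ p + p / (2 + p) * |z| ^ (2 : ℝ)) := by gcongr
    _ = _ := by field_simp

theorem integrable_pairLaw_mul (hp : 0 < p) :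
    Integrable (fun x : ℝ × ℝ => x.1 * x.2) (pairLaw p) := by
  have hid : ∀ {q : ℝ}, 0 < q → Integrable (fun x : ℝ => x) (expPowLaw q) := fun hq => by
    have := integrable_expPowLaw_abs_rpow hq zero_le_one
    simp only [Real.rpow_one] at this
    exact (integrable_norm_iff measurable_id.aestronglyMeasurable).1 this
  have := isProbabilityMeasure_expPowLaw hp
  have := isProbabilityMeasure_expPowLaw (q := 2) (by norm_num)
  exact (hid hp).mul_prod (hid two_pos)

theorem integral_pairLaw_mul : ∫ x : ℝ × ℝ, x.1 * x.2 ∂(pairLaw p) = 0 := by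
  have := isProbabilityMeasure_expPowLaw (q := 2) (by norm_num)
  by_cases h : Integrable (fun x : ℝ => Real.exp (-(|x| ^ p / p)))
  · have : IsProbabilityMeasure (expPowLaw p) := isProbabilityMeasure_tilted h
    rw [pairLaw, integral_prod_mul (fun x => x) (fun x => x), integral_expPowLaw_id, zero_mul]
  · rw [pairLaw, expPowLaw, tilted_of_not_integrable h]; simp

theorem integrable_pairLaw_mul_sq_mul_exp (hp : 0 < p) {b : ℝ} (hb0 : 0 < b)
    (hb : b < (2 + p) / (2 * p)) {f : ℝ × ℝ → ℝ} (hf : Measurable f)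
    (hfle : ∀ x, |f x| = |x.1 * x.2|) :
    Integrable (fun x => f x ^ 2 * Real.exp (b * max (f x) 0 ^ (2 * p / (2 + p)))) (pairLaw p) := by
  have := isProbabilityMeasure_expPowLaw hp
  have := isProbabilityMeasure_expPowLaw (q := 2) (by norm_num)
  set t := b * (2 * p / (2 + p)) with ht
  have ht0 : 0 < t := by positivity
  have ht1 : t < 1 := by
    rw [lt_div_iff₀ (by positivity)] at hb
    rw [ht, mul_div_assoc', div_lt_one (by positivity)]
    linarith
  have h1 : Integrable (fun x : ℝ => |x| ^ (2 : ℝ) * Real.exp (t / p * |x| ^ p)) (expPowLaw p) :=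
    integrable_expPowLaw_abs_rpow_mul_exp hp zero_le_two (by gcongr)
  have h2 : Integrable (fun x : ℝ => |x| ^ (2 : ℝ) * Real.exp (t / 2 * |x| ^ (2 : ℝ)))
      (expPowLaw 2) :=
    integrable_expPowLaw_abs_rpow_mul_exp two_pos zero_le_two (by gcongr)
  refine (h1.mul_prod h2).mono' (by fun_prop) (ae_of_all _ fun x => ?_)
  rw [Real.norm_eq_abs, abs_mul, abs_of_pos (Real.exp_pos _), abs_pow, hfle]
  have h3 : max (f x) 0 ≤ |x.1 * x.2| := by
    rw [← hfle]; exact max_le (le_abs_self _) (abs_nonneg _)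
  have h4 : b * max (f x) 0 ^ (2 * p / (2 + p)) ≤
      t / p * |x.1| ^ p + t / 2 * |x.2| ^ (2 : ℝ) := by
    have h5 := mul_abs_mul_rpow_le hp x.1 x.2
    calc b * max (f x) 0 ^ (2 * p / (2 + p)) ≤ b * |x.1 * x.2| ^ (2 * p / (2 + p)) := by gcongr
      _ = t * ((2 + p) / (2 * p) * |x.1 * x.2| ^ (2 * p / (2 + p))) := by
        rw [ht]; field_simp
      _ ≤ t * (|x.1| ^ p / p + |x.2| ^ (2 : ℝ) / 2) := by gcongr
      _ = _ := by ring
  calc |x.1 * x.2| ^ 2 * Real.exp (b * max (f x) 0 ^ (2 * p / (2 + p)))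
      ≤ |x.1 * x.2| ^ 2 * Real.exp (t / p * |x.1| ^ p + t / 2 * |x.2| ^ (2 : ℝ)) := by gcongr
    _ = _ := by
      rw [Real.exp_add, abs_mul, mul_pow, Real.rpow_two, Real.rpow_two]; ring

theorem integrable_comp_fst_pairLaw (hp : 0 < p) {f : ℝ → ℝ} (hf : Integrable f (expPowLaw p)) :
    Integrable (fun x : ℝ × ℝ => f x.1) (pairLaw p) ∧
      ∫ x, f x.1 ∂(pairLaw p) = ∫ x, f x ∂(expPowLaw p) := by
  have := isProbabilityMeasure_expPowLaw hp
  have := isProbabilityMeasure_expPowLaw (q := 2) (by norm_num)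
  refine ⟨hf.comp_fst _, ?_⟩
  rw [pairLaw, integral_fun_fst]; simp

theorem integrable_comp_snd_pairLaw (hp : 0 < p) {f : ℝ → ℝ} (hf : Integrable f (expPowLaw 2)) :
    Integrable (fun x : ℝ × ℝ => f x.2) (pairLaw p) ∧
      ∫ x, f x.2 ∂(pairLaw p) = ∫ x, f x ∂(expPowLaw 2) := by
  have := isProbabilityMeasure_expPowLaw hp
  have := isProbabilityMeasure_expPowLaw (q := 2) (by norm_num)
  refine ⟨hf.comp_snd _, ?_⟩
  rw [pairLaw, integral_fun_snd]; simp

end PairLaw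

/-- The normalized inner product of the two coordinate sequences of `x`. -/
noncomputable def normStat (p : ℝ) (n : ℕ) (x : Fin n → ℝ × ℝ) : ℝ :=
  (n : ℝ) ^ (1 / p - 1 / 2) * ((∑ i, (x i).1 * (x i).2) /
    ((∑ i, |(x i).1| ^ p) ^ (1 / p) * (∑ i, |(x i).2| ^ (2 : ℝ)) ^ (1 / (2 : ℝ))))

theorem normStat_eq {p : ℝ} {n : ℕ} (hn : 0 < n) (x : Fin n → ℝ × ℝ) :
    normStat p n x = (∑ i, (x i).1 * (x i).2) / n /
      (((∑ i, |(x i).1| ^ p) / n) ^ (1 / p) *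
        ((∑ i, |(x i).2| ^ (2 : ℝ)) / n) ^ (1 / (2 : ℝ))) := by
  have hn' : (0 : ℝ) < n := by exact_mod_cast hn
  have hA : 0 ≤ ∑ i, |(x i).1| ^ p := Finset.sum_nonneg fun _ _ => by positivity
  have hB : 0 ≤ ∑ i, |(x i).2| ^ (2 : ℝ) := Finset.sum_nonneg fun _ _ => by positivity
  rw [normStat, Real.div_rpow hA hn'.le, Real.div_rpow hB hn'.le, Real.rpow_sub hn']
  have e : (n : ℝ) = (n : ℝ) ^ (1 / (2 : ℝ)) * (n : ℝ) ^ (1 / (2 : ℝ)) := by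
    rw [← Real.rpow_add hn']; norm_num
  have h2 : (0 : ℝ) < (n : ℝ) ^ (1 / (2 : ℝ)) := by positivity
  have hp : (0 : ℝ) < (n : ℝ) ^ (1 / p) := by positivity
  generalize (n : ℝ) ^ (1 / (2 : ℝ)) = u at *
  generalize (n : ℝ) ^ (1 / p) = v at *
  rw [e]
  generalize (∑ i, |(x i).1| ^ p) ^ (1 / p) = a
  generalize (∑ i, |(x i).2| ^ (2 : ℝ)) ^ (1 / (2 : ℝ)) = b
  field_simp

section Estimates

variable {p : ℝ}

theorem integrable_one_sub_sq_mul_exp {Ω : Type*} [MeasurableSpace Ω] {ρ : Measure Ω}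
    [IsFiniteMeasure ρ] {u : Ω → ℝ} (hum : Measurable u) (hu0 : ∀ x, 0 ≤ u x)
    (hu : Integrable u ρ) (hu2 : Integrable (fun x => u x ^ 2) ρ) {b r : ℝ} (hb : 0 < b)
    (hr : 0 < r) :
    Integrable (fun x => (1 - u x) ^ 2 * Real.exp (b * max (1 - u x) 0 ^ r)) ρ := by
  have h : Integrable (fun x => (1 - 2 * u x + u x ^ 2) * Real.exp b) ρ :=
    (((integrable_const _).sub (hu.const_mul 2)).add hu2).mul_const _
  refine h.mono' (by fun_prop) (ae_of_all _ fun x => ?_)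
  rw [Real.norm_eq_abs, abs_of_nonneg (by positivity)]
  have h1 : max (1 - u x) 0 ≤ 1 := max_le (by linarith [hu0 x]) zero_le_one
  have h2 : max (1 - u x) 0 ^ r ≤ 1 := Real.rpow_le_one (le_max_right _ _) h1 hr.le
  have h3 : Real.exp (b * max (1 - u x) 0 ^ r) ≤ Real.exp b :=
    Real.exp_le_exp.2 (mul_le_of_le_one_right hb.le h2)
  calc _ ≤ (1 - u x) ^ 2 * Real.exp b := by gcongr
    _ = _ := by ring

theorem integrable_pairLaw_abs_rpow (hp : 0 < p) :
    Integrable (fun x : ℝ × ℝ => |x.1| ^ p) (pairLaw p) ∧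
    Integrable (fun x : ℝ × ℝ => |x.2| ^ (2 : ℝ)) (pairLaw p) ∧
    Integrable (fun x : ℝ × ℝ => (|x.1| ^ p) ^ 2) (pairLaw p) ∧
    Integrable (fun x : ℝ × ℝ => (|x.2| ^ (2 : ℝ)) ^ 2) (pairLaw p) ∧
    ∫ x, |x.1| ^ p ∂(pairLaw p) = 1 ∧ ∫ x, |x.2| ^ (2 : ℝ) ∂(pairLaw p) = 1 := by
  have h1 := integrable_comp_fst_pairLaw hp (integrable_expPowLaw_abs_rpow hp hp.le)
  have h2 := integrable_comp_snd_pairLaw hp (integrable_expPowLaw_abs_rpow two_pos zero_le_two)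
  have hsq : ∀ (k y : ℝ), (|y| ^ k) ^ 2 = |y| ^ (k * 2) := fun k y => by
    rw [Real.rpow_mul (abs_nonneg _), Real.rpow_two]
  simp_rw [hsq]
  refine ⟨h1.1, h2.1, (integrable_comp_fst_pairLaw hp
      (integrable_expPowLaw_abs_rpow hp (by positivity))).1, (integrable_comp_snd_pairLaw hp
      (integrable_expPowLaw_abs_rpow two_pos (by positivity))).1, ?_, ?_⟩
  · rw [h1.2, integral_expPowLaw_abs_rpow hp]
  · rw [h2.2, integral_expPowLaw_abs_rpow two_pos]

theorem abs_normStat_lt {n : ℕ} (hn : 0 < n) (hp : 0 < p) {s w : ℝ} (hs : 0 < s)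
    (hw : 0 < w) {x : Fin n → ℝ × ℝ}
    (hS : |∑ i, (x i).1 * (x i).2| < w * s ^ (1 / p) * s ^ (1 / (2 : ℝ)) * n)
    (hA : s * n < ∑ i, |(x i).1| ^ p) (hB : s * n < ∑ i, |(x i).2| ^ (2 : ℝ)) :
    |normStat p n x| < w := by
  have hn' : (0 : ℝ) < n := by exact_mod_cast hn
  rw [normStat_eq hn, abs_div, abs_div, abs_of_pos hn']
  rw [← lt_div_iff₀ hn'] at hA hB
  have hA' : s ^ (1 / p) ≤ ((∑ i, |(x i).1| ^ p) / n) ^ (1 / p) := by gcongr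
  have hB' : s ^ (1 / (2 : ℝ)) ≤ ((∑ i, |(x i).2| ^ (2 : ℝ)) / n) ^ (1 / (2 : ℝ)) := by gcongr
  have h1 : 0 < s ^ (1 / p) := by positivity
  have h2 : 0 < s ^ (1 / (2 : ℝ)) := by positivity
  have hpos := mul_pos (h1.trans_le hA') (h2.trans_le hB')
  rw [abs_of_pos hpos, div_lt_iff₀ hpos, div_lt_iff₀ hn']
  refine hS.trans_le ?_
  rw [mul_assoc w]
  gcongr

theorem expDecay_normStat (hp : 1 ≤ p) (hp2 : p < 2) {w : ℝ} (hw : 0 < w) :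
    ExpDecay (2 * p / (2 + p)) ((2 + p) / (2 * p) * w ^ (2 * p / (2 + p)))
      (fun n => Measure.pi (fun _ : Fin n => pairLaw p) {x | w ≤ |normStat p n x|}) := by
  have hp0 : 0 < p := by linarith
  have := isProbabilityMeasure_pairLaw hp0
  set r := 2 * p / (2 + p) with hr
  set c := (2 + p) / (2 * p) with hc
  have hr0 : 0 < r := by positivity
  have hr1 : r < 1 := by rw [hr, div_lt_one (by positivity)]; linarith
  have hc0 : 0 < c := by positivity
  intro κ hκ
  obtain ⟨s, ⟨hs0, hs1⟩, hsκ⟩ : ∃ s ∈ Ioo (0 : ℝ) 1,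
      κ < c * s * (w * s ^ (1 / p) * s ^ (1 / (2 : ℝ))) ^ r := by
    have hcont : ContinuousAt
        (fun s : ℝ => c * s * (w * s ^ (1 / p) * s ^ (1 / (2 : ℝ))) ^ r) 1 := by
      have h1 : ContinuousAt (fun s : ℝ => s ^ (1 / p)) 1 :=
        Real.continuousAt_rpow_const _ _ (Or.inl one_ne_zero)
      have h2 : ContinuousAt (fun s : ℝ => s ^ (1 / (2 : ℝ))) 1 :=
        Real.continuousAt_rpow_const _ _ (Or.inl one_ne_zero)
      exact (continuousAt_const.mul continuousAt_id).mul
        (((continuousAt_const.mul h1).mul h2).rpow_const (Or.inr hr0.le))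
    have h1 : ∀ᶠ s in 𝓝 (1 : ℝ), κ < c * s * (w * s ^ (1 / p) * s ^ (1 / (2 : ℝ))) ^ r :=
      hcont.eventually_const_lt (by simpa using hκ)
    have h2 : ∀ᶠ s in 𝓝[<] (1 : ℝ), s ∈ Ioo (0 : ℝ) 1 := Ioo_mem_nhdsLT zero_lt_one
    obtain ⟨s, h3, h4⟩ := ((h1.filter_mono nhdsWithin_le_nhds).and h2).exists
    exact ⟨s, h4, h3⟩
  set v := w * s ^ (1 / p) * s ^ (1 / (2 : ℝ)) with hv
  have hv0 : 0 < v := by positivity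
  have hδ : 0 < 1 - s := by linarith
  obtain ⟨i1, i2, i3, i4, m1, m2⟩ := integrable_pairLaw_abs_rpow hp0
  have hcs : c * s < c := mul_lt_of_lt_one_right hc0 hs1
  have d1 : ExpDecay r (c * s * v ^ r) (fun n => Measure.pi (fun _ : Fin n => pairLaw p)
      {x | v * n ≤ ∑ i, (x i).1 * (x i).2}) :=
    expDecay_sum_ge (f := fun x : ℝ × ℝ => x.1 * x.2) (by fun_prop)
      (integrable_pairLaw_mul hp0) integral_pairLaw_mul hr0 hr1 (by positivity) hv0
      (integrable_pairLaw_mul_sq_mul_exp hp0 (by positivity) hcs (by fun_prop) fun _ => rfl)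
  have d2 : ExpDecay r (c * s * v ^ r) (fun n => Measure.pi (fun _ : Fin n => pairLaw p)
      {x | v * n ≤ ∑ i, -((x i).1 * (x i).2)}) :=
    expDecay_sum_ge (f := fun x : ℝ × ℝ => -(x.1 * x.2)) (by fun_prop)
      (integrable_pairLaw_mul hp0).neg (by rw [integral_neg, integral_pairLaw_mul, neg_zero])
      hr0 hr1 (by positivity) hv0
      (integrable_pairLaw_mul_sq_mul_exp hp0 (by positivity) hcs (by fun_prop) fun _ => abs_neg _)
  set B := c * s * v ^ r / (1 - s) ^ r with hB
  have hB0 : 0 < B := by positivity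
  have hBe : c * s * v ^ r = B * (1 - s) ^ r := by rw [hB]; field_simp
  have d3 : ExpDecay r (c * s * v ^ r) (fun n => Measure.pi (fun _ : Fin n => pairLaw p)
      {x | (1 - s) * n ≤ ∑ i, (1 - |(x i).1| ^ p)}) := by
    rw [hBe]
    exact expDecay_sum_ge (f := fun x : ℝ × ℝ => 1 - |x.1| ^ p) (by fun_prop)
      ((integrable_const _).sub i1) (by rw [integral_sub (integrable_const _) i1, m1]; simp)
      hr0 hr1 hB0 hδ
      (integrable_one_sub_sq_mul_exp (by fun_prop) (fun _ => by positivity) i1 i3 hB0 hr0)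
  have d4 : ExpDecay r (c * s * v ^ r) (fun n => Measure.pi (fun _ : Fin n => pairLaw p)
      {x | (1 - s) * n ≤ ∑ i, (1 - |(x i).2| ^ (2 : ℝ))}) := by
    rw [hBe]
    exact expDecay_sum_ge (f := fun x : ℝ × ℝ => 1 - |x.2| ^ (2 : ℝ)) (by fun_prop)
      ((integrable_const _).sub i2) (by rw [integral_sub (integrable_const _) i2, m2]; simp)
      hr0 hr1 hB0 hδ
      (integrable_one_sub_sq_mul_exp (by fun_prop) (fun _ => by positivity) i2 i4 hB0 hr0)
  refine ((((d1.add hr0 d2).add hr0 (d3.add hr0 d4)).of_eventually_le le_rfl ?_)) κ hsκ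
  filter_upwards [eventually_gt_atTop 0] with n hn
  refine le_trans (measure_mono ?_) ((measure_union_le _ _).trans
    (add_le_add (measure_union_le _ _) (measure_union_le _ _)))
  intro x hx
  by_contra hcon
  simp only [mem_union, mem_ofPred_eq, not_or, not_le, Finset.sum_sub_distrib, Finset.sum_const,
    Finset.card_univ, Fintype.card_fin, nsmul_eq_mul, mul_one, Finset.sum_neg_distrib] at hcon
  obtain ⟨⟨h1, h2⟩, h3, h4⟩ := hcon
  refine (not_lt.2 hx) (abs_normStat_lt hn hp0 hs0 hw ?_ ?_ ?_)
  · rw [← hv, abs_lt]; constructor <;> linarith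
  · linarith
  · linarith

end Estimates

section LowerBound

variable {p : ℝ}

theorem eventually_half_le_pi_pairLaw (hp : 0 < p) {ε : ℝ} (hε : 0 < ε) :
    ∀ᶠ n : ℕ in atTop, (2⁻¹ : ℝ≥0∞) ≤ Measure.pi (fun _ : Fin n => pairLaw p)
      {x | |∑ i, (x i).1 * (x i).2| < ε * n ∧ |∑ i, |(x i).1| ^ p - n| < ε * n ∧
        |∑ i, |(x i).2| ^ (2 : ℝ) - n| < ε * n} := by
  have := isProbabilityMeasure_pairLaw hp
  obtain ⟨i1, i2, i3, i4, m1, m2⟩ := integrable_pairLaw_abs_rpow hp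
  have l0 : MemLp (fun x : ℝ × ℝ => x.1 * x.2) 2 (pairLaw p) := by
    rw [memLp_two_iff_integrable_sq (by fun_prop)]
    have hc : 0 < (2 + p) / (2 * p) := by positivity
    have h := integrable_pairLaw_mul_sq_mul_exp hp (half_pos hc) (half_lt_self hc)
      (f := fun x => x.1 * x.2) (by fun_prop) fun _ => rfl
    refine h.mono' (by fun_prop) (ae_of_all _ fun x => ?_)
    rw [Real.norm_eq_abs, abs_of_nonneg (sq_nonneg _)]
    exact le_mul_of_one_le_right (sq_nonneg _) (Real.one_le_exp (by positivity))
  have l1 : MemLp (fun x : ℝ × ℝ => |x.1| ^ p) 2 (pairLaw p) := by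
    rwa [memLp_two_iff_integrable_sq i1.aestronglyMeasurable]
  have l2 : MemLp (fun x : ℝ × ℝ => |x.2| ^ (2 : ℝ)) 2 (pairLaw p) := by
    rwa [memLp_two_iff_integrable_sq i2.aestronglyMeasurable]
  have t0 := tendsto_pi_abs_sum_sub_ge l0 integral_pairLaw_mul hε
  have t1 := tendsto_pi_abs_sum_sub_ge l1 m1 hε
  have t2 := tendsto_pi_abs_sum_sub_ge l2 m2 hε
  have t := (t0.add t1).add t2
  simp only [mul_zero, sub_zero, mul_one, add_zero] at t
  filter_upwards [t.eventually_le_const (ENNReal.inv_pos.2 ENNReal.ofNat_ne_top : (0 : ℝ≥0∞) < 2⁻¹)]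
    with n hn
  set G := {x : Fin n → ℝ × ℝ | |∑ i, (x i).1 * (x i).2| < ε * n ∧
    |∑ i, |(x i).1| ^ p - n| < ε * n ∧ |∑ i, |(x i).2| ^ (2 : ℝ) - n| < ε * n} with hG
  have hGc : Measure.pi (fun _ : Fin n => pairLaw p) Gᶜ ≤ 2⁻¹ := by
    refine le_trans (measure_mono ?_) ((measure_union_le _ _).trans
      (add_le_add_left (measure_union_le _ _) _) |>.trans hn)
    intro x hx
    by_contra hcon
    simp only [mem_union, mem_ofPred_eq, not_or, not_le] at hcon
    exact hx ⟨hcon.1.1, hcon.1.2, hcon.2⟩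
  have h1 : (1 : ℝ≥0∞) ≤ Measure.pi (fun _ : Fin n => pairLaw p) G + 2⁻¹ := by
    calc (1 : ℝ≥0∞) = Measure.pi (fun _ : Fin n => pairLaw p) univ := measure_univ.symm
      _ ≤ Measure.pi (fun _ : Fin n => pairLaw p) G + Measure.pi (fun _ : Fin n => pairLaw p) Gᶜ :=
        by rw [← union_compl_self G]; exact measure_union_le _ _
      _ ≤ _ := by gcongr
  rw [← ENNReal.inv_two_add_inv_two] at h1
  exact (ENNReal.add_le_add_iff_right (by simp)).1 h1

theorem pi_succ_ge {Ω : Type*} [MeasurableSpace Ω] (ρ : Measure Ω) [SigmaFinite ρ] (m : ℕ)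
    (A : Set Ω) (B : Set (Fin m → Ω)) {G : Set (Fin (m + 1) → Ω)}
    (h : ∀ x : Fin (m + 1) → Ω, x 0 ∈ A → (fun j => x (Fin.succ j)) ∈ B → x ∈ G) :
    ρ A * Measure.pi (fun _ : Fin m => ρ) B ≤ Measure.pi (fun _ : Fin (m + 1) => ρ) G := by
  rw [← Measure.prod_prod]
  have hmp := measurePreserving_piFinSuccAbove (fun _ : Fin (m + 1) => ρ) 0
  rw [← hmp.map_eq, MeasurableEquiv.map_apply]
  refine measure_mono fun x hx => h x hx.1 ?_
  have := hx.2
  simpa [MeasurableEquiv.piFinSuccAbove, Fin.insertNthEquiv, Fin.removeNth, Fin.tail_def] using this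

theorem abs_mul_sub_mul_le {y z h₁ h₂ α β ε : ℝ} (h1 : 0 ≤ h₁) (h2 : 0 ≤ h₂) (hε : 0 ≤ ε)
    (hy : |y - α * h₁| ≤ ε * h₁) (hz : |z - β * h₂| ≤ ε * h₂) :
    |y * z - α * β * (h₁ * h₂)| ≤ ε * (|α| + |β| + ε) * (h₁ * h₂) := by
  have e : y * z - α * β * (h₁ * h₂) =
      (y - α * h₁) * (z - β * h₂) + (y - α * h₁) * (β * h₂) + α * h₁ * (z - β * h₂) := by ring
  rw [e]
  refine (abs_add_three _ _ _).trans ?_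
  rw [abs_mul, abs_mul, abs_mul, abs_mul, abs_mul, abs_of_nonneg h1, abs_of_nonneg h2]
  have i1 := mul_le_mul hy hz (abs_nonneg _) (by positivity)
  have i2 := mul_le_mul_of_nonneg_right hy (by positivity : 0 ≤ |β| * h₂)
  have i3 := mul_le_mul_of_nonneg_left hz (by positivity : 0 ≤ |α| * h₁)
  linarith

theorem abs_rpow_le_of_abs_sub_le {y h a ε q : ℝ} (hh : 0 ≤ h) (hε : 0 ≤ ε) (hq : 0 ≤ q)
    (hy : |y - a * h| ≤ ε * h) : |y| ^ q ≤ (|a| + ε) ^ q * h ^ q := by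
  rw [← Real.mul_rpow (by positivity) hh]
  have h3 : |y| ≤ |y - a * h| + |a * h| := by simpa using abs_add_le (y - a * h) (a * h)
  rw [abs_mul, abs_of_nonneg hh] at h3
  refine Real.rpow_le_rpow (abs_nonneg _) (by linarith) hq

theorem exists_optimal_split (hp : 0 < p) {w κ : ℝ} (hw : w ≠ 0)
    (hκ : (2 + p) / (2 * p) * |w| ^ (2 * p / (2 + p)) < κ) {δ : ℝ} (hδ : 0 < δ) :
    ∃ α β ε : ℝ, 0 < ε ∧ α * β = w ∧ ε * (|α| + |β| + ε) < δ ∧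
      (|α| + ε) ^ p / p + (|β| + ε) ^ (2 : ℝ) / 2 < κ := by
  have hw0 : 0 < |w| := abs_pos.2 hw
  set α := |w| ^ (2 / (2 + p)) with hα
  have hα0 : 0 < α := by positivity
  have hβ : |w / α| = |w| ^ (p / (2 + p)) := by
    rw [abs_div, abs_of_pos hα0, hα, div_eq_iff (by positivity), ← Real.rpow_add hw0,
      ← add_div, add_comm, div_self (by positivity), Real.rpow_one]
  refine ⟨α, w / α, ?_⟩
  have c1 : ContinuousAt (fun ε : ℝ => ε * (|α| + |w / α| + ε)) 0 := by fun_prop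
  have c2 : ContinuousAt
      (fun ε : ℝ => (|α| + ε) ^ p / p + (|w / α| + ε) ^ (2 : ℝ) / 2) 0 := by
    have h1 : ContinuousAt (fun ε : ℝ => (|α| + ε) ^ p) 0 :=
      (by fun_prop : ContinuousAt (fun ε : ℝ => |α| + ε) 0).rpow_const (Or.inr hp.le)
    have h2 : ContinuousAt (fun ε : ℝ => (|w / α| + ε) ^ (2 : ℝ)) 0 :=
      (by fun_prop : ContinuousAt (fun ε : ℝ => |w / α| + ε) 0).rpow_const (Or.inr zero_le_two)
    exact (h1.div_const _).add (h2.div_const _)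
  have hval : (|α| + 0) ^ p / p + (|w / α| + 0) ^ (2 : ℝ) / 2 < κ := by
    rw [add_zero, add_zero, hβ, abs_of_pos hα0, hα, ← Real.rpow_mul hw0.le, ← Real.rpow_mul hw0.le]
    have e1 : 2 / (2 + p) * p = 2 * p / (2 + p) := by ring
    have e2 : p / (2 + p) * 2 = 2 * p / (2 + p) := by ring
    rw [e1, e2]
    refine lt_of_eq_of_lt ?_ hκ
    field_simp
  have e1 := c1.eventually_lt_const (u := δ) (by simpa using hδ)
  have e2 := c2.eventually_lt_const hval
  obtain ⟨ε, ⟨h1, h2⟩, h3⟩ := (((e1.and e2).filter_mono nhdsWithin_le_nhds).and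
    (self_mem_nhdsWithin : Ioi (0 : ℝ) ∈ 𝓝[>] (0 : ℝ))).exists
  exact ⟨ε, h3, by field_simp, h1, h2⟩

theorem exists_ratio_close (p w : ℝ) {η : ℝ} (hη : 0 < η) :
    ∃ δ > 0, ∀ s a b : ℝ, |s - w| < δ → |a - 1| < δ → |b - 1| < δ →
      |s / (a ^ (1 / p) * b ^ (1 / (2 : ℝ))) - w| < η := by
  have hcont : ContinuousAt
      (fun x : ℝ × ℝ × ℝ => x.1 / (x.2.1 ^ (1 / p) * x.2.2 ^ (1 / (2 : ℝ)))) (w, 1, 1) := by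
    have h1 : ContinuousAt (fun x : ℝ × ℝ × ℝ => x.2.1 ^ (1 / p)) (w, 1, 1) :=
      (by fun_prop : ContinuousAt (fun x : ℝ × ℝ × ℝ => x.2.1) (w, 1, 1)).rpow_const
        (Or.inl one_ne_zero)
    have h2 : ContinuousAt (fun x : ℝ × ℝ × ℝ => x.2.2 ^ (1 / (2 : ℝ))) (w, 1, 1) :=
      (by fun_prop : ContinuousAt (fun x : ℝ × ℝ × ℝ => x.2.2) (w, 1, 1)).rpow_const
        (Or.inl one_ne_zero)
    exact continuousAt_fst.div (h1.mul h2) (by simp)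
  obtain ⟨δ, hδ, h⟩ := Metric.continuousAt_iff.1 hcont η hη
  refine ⟨δ, hδ, fun s a b hs ha hb => ?_⟩
  have := h (x := (s, a, b)) (by
    simp only [Prod.dist_eq, Real.dist_eq, max_lt_iff]; exact ⟨hs, ha, hb⟩)
  simpa [Real.dist_eq] using this

theorem eventually_normStat_near_ge (hp : 1 ≤ p) (hp2 : p < 2) {w η κ : ℝ} (hw : w ≠ 0)
    (hη : 0 < η) (hκ : (2 + p) / (2 * p) * |w| ^ (2 * p / (2 + p)) < κ) :
    ∀ᶠ n : ℕ in atTop, ENNReal.ofReal (Real.exp (-(κ * (n : ℝ) ^ (2 * p / (2 + p))))) ≤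
      Measure.pi (fun _ : Fin n => pairLaw p) {x | |normStat p n x - w| < η} := by
  have hp0 : 0 < p := by linarith
  have := isProbabilityMeasure_pairLaw hp0
  have := isProbabilityMeasure_expPowLaw hp0
  have := isProbabilityMeasure_expPowLaw (q := 2) (by norm_num)
  obtain ⟨δ, hδ, hclose⟩ := exists_ratio_close p w hη
  obtain ⟨α, β, ε, hε, hαβ, hprod, hκ'⟩ := exists_optimal_split hp0 hw hκ (half_pos hδ)
  obtain ⟨C₁, hC₁, hlow₁⟩ := expPowLaw_interval_ge hp0 α hε
  obtain ⟨C₂, hC₂, hlow₂⟩ := expPowLaw_interval_ge two_pos β hε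
  set r := 2 * p / (2 + p) with hr
  have hr0 : 0 < r := by positivity
  have hr1 : r < 1 := by rw [hr, div_lt_one (by positivity)]; linarith
  set a₁ := (|α| + ε) ^ p with ha₁
  set a₂ := (|β| + ε) ^ (2 : ℝ) with ha₂
  have ha₁0 : 0 ≤ a₁ := by positivity
  have ha₂0 : 0 ≤ a₂ := by positivity
  have hsub : ∀ a : ℝ, Tendsto (fun n : ℕ => (a * (n : ℝ) ^ r + 1) / n) atTop (𝓝 0) := by
    intro a
    have h1 : Tendsto (fun n : ℕ => a * ((n : ℝ) ^ (1 - r))⁻¹ + (n : ℝ)⁻¹) atTop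
        (𝓝 (a * 0 + 0)) :=
      (((tendsto_natCast_rpow (by linarith)).inv_tendsto_atTop).const_mul _).add
        tendsto_inv_atTop_nhds_zero_nat
    rw [mul_zero, add_zero] at h1
    refine h1.congr' ?_
    filter_upwards [eventually_gt_atTop 0] with n hn0
    have hn0' : (0 : ℝ) < n := by exact_mod_cast hn0
    rw [Real.rpow_sub hn0', Real.rpow_one]
    field_simp
  have hC : 0 < C₁ * C₂ / 2 := by positivity
  set κ' := a₁ / p + a₂ / 2 with hκ'_def
  have hexp : ∀ᶠ n : ℕ in atTop, Real.exp (-(κ * (n : ℝ) ^ r)) ≤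
      C₁ * C₂ / 2 * Real.exp (-(κ' * (n : ℝ) ^ r)) := by
    filter_upwards [(tendsto_natCast_rpow hr0).eventually_ge_atTop
      (-Real.log (C₁ * C₂ / 2) / (κ - κ'))] with n hn
    rw [div_le_iff₀ (by linarith)] at hn
    calc Real.exp (-(κ * (n : ℝ) ^ r)) ≤
        Real.exp (Real.log (C₁ * C₂ / 2) + -(κ' * (n : ℝ) ^ r)) :=
          Real.exp_le_exp.2 (by linarith)
      _ = _ := by rw [Real.exp_add, Real.exp_log hC]
  rw [← Filter.map_add_atTop_eq_nat 1, Filter.eventually_map]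
  filter_upwards [eventually_half_le_pi_pairLaw hp0 (by positivity : 0 < δ / 4),
    (tendsto_add_atTop_nat 1).eventually hexp,
    (tendsto_add_atTop_nat 1).eventually
      ((hsub a₁).eventually_lt_const (by positivity : 0 < δ / 4)),
    (tendsto_add_atTop_nat 1).eventually
      ((hsub a₂).eventually_lt_const (by positivity : 0 < δ / 4))] with m hhalf hexp hs₁ hs₂
  set N : ℝ := ((m + 1 : ℕ) : ℝ) with hN
  have hNm : N = m + 1 := by rw [hN]; push_cast; ring
  have hm0 : (0 : ℝ) ≤ m := m.cast_nonneg
  have hN1 : 1 ≤ N := by linarith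
  have hN0 : 0 < N := by linarith
  set h₁ := N ^ (2 / (2 + p)) with hh₁
  set h₂ := N ^ (p / (2 + p)) with hh₂
  have hh₁1 : 1 ≤ h₁ := Real.one_le_rpow hN1 (by positivity)
  have hh₂1 : 1 ≤ h₂ := Real.one_le_rpow hN1 (by positivity)
  have hmul : h₁ * h₂ = N := by
    rw [hh₁, hh₂, ← Real.rpow_add hN0, ← add_div, div_self (by positivity), Real.rpow_one]
  have hpow₁ : h₁ ^ p = N ^ r := by rw [hh₁, ← Real.rpow_mul hN0.le, hr]; ring_nf
  have hpow₂ : h₂ ^ (2 : ℝ) = N ^ r := by rw [hh₂, ← Real.rpow_mul hN0.le, hr]; ring_nf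
  have hlow := hlow₁ h₁ hh₁1
  have hlow' := hlow₂ h₂ hh₂1
  rw [hpow₁] at hlow
  rw [hpow₂] at hlow'
  have hE : ENNReal.ofReal (C₁ * C₂ * Real.exp (-(κ' * N ^ r))) ≤
      pairLaw p ({y | |y - α * h₁| ≤ ε * h₁} ×ˢ {z | |z - β * h₂| ≤ ε * h₂}) := by
    rw [pairLaw, Measure.prod_prod]
    refine le_trans (le_of_eq ?_) (mul_le_mul' hlow hlow')
    rw [← ENNReal.ofReal_mul (by positivity)]
    congr 1
    rw [hκ'_def, mul_mul_mul_comm, ← Real.exp_add]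
    ring_nf
  refine (ENNReal.ofReal_le_ofReal hexp).trans ?_
  refine le_trans ?_ ((mul_le_mul' hE hhalf).trans (pi_succ_ge (pairLaw p) m _ _ ?_))
  · have : (2⁻¹ : ℝ≥0∞) = ENNReal.ofReal 2⁻¹ := by
      rw [ENNReal.ofReal_inv_of_pos two_pos]; simp
    rw [this, ← ENNReal.ofReal_mul (by positivity)]
    exact ENNReal.ofReal_le_ofReal (le_of_eq (by ring))
  · rintro x ⟨hy, hz⟩ ⟨r0, r1, r2⟩
    simp only [mem_ofPred_eq] at hy hz r0 r1 r2 ⊢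
    rw [normStat_eq m.succ_pos, Fin.sum_univ_succ, Fin.sum_univ_succ, Fin.sum_univ_succ]
    set S := ∑ i : Fin m, (x i.succ).1 * (x i.succ).2
    set A := ∑ i : Fin m, |(x i.succ).1| ^ p
    set B := ∑ i : Fin m, |(x i.succ).2| ^ (2 : ℝ)
    have hyz := abs_mul_sub_mul_le (by linarith) (by linarith) hε.le hy hz
    rw [hmul, hαβ] at hyz
    have hyp := abs_rpow_le_of_abs_sub_le (by linarith) hε.le hp0.le hy
    have hzp := abs_rpow_le_of_abs_sub_le (by linarith) hε.le zero_le_two hz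
    rw [← ha₁, hpow₁] at hyp
    rw [← ha₂, hpow₂] at hzp
    rw [div_lt_iff₀ hN0] at hs₁ hs₂
    have hδN : δ / 4 * m ≤ δ / 4 * N := by gcongr; linarith
    have hprodN : ε * (|α| + |β| + ε) * N ≤ δ / 2 * N := by gcongr
    have hpos : 0 < δ * N := by positivity
    have hy0 : 0 ≤ |(x 0).1| ^ p := by positivity
    have hz0 : 0 ≤ |(x 0).2| ^ (2 : ℝ) := by positivity
    rw [abs_lt] at r0 r1 r2
    rw [abs_le] at hyz
    have hkey : ∀ t c : ℝ, |t - c * N| < δ * N → |t / N - c| < δ := by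
      intro t c ht
      have : t / N - c = (t - c * N) / N := by field_simp
      rw [this, abs_div, abs_of_pos hN0, div_lt_iff₀ hN0]
      exact ht
    apply hclose
    · apply hkey; rw [abs_lt]; constructor <;> linarith
    · apply hkey; rw [abs_lt]; constructor <;> linarith
    · apply hkey; rw [abs_lt]; constructor <;> linarith

end LowerBound

section PNorm

variable {n : ℕ} {q : ℝ}

theorem pnorm_nonneg (x : EuclideanSpace ℝ (Fin n)) : 0 ≤ pnorm q x := by
  unfold pnorm; positivity

theorem continuous_pnorm (hq : 0 < q) :
    Continuous (pnorm q : EuclideanSpace ℝ (Fin n) → ℝ) := by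
  have h : ∀ i, Continuous fun x : EuclideanSpace ℝ (Fin n) => |x i| ^ q := fun i =>
    (by fun_prop : Continuous fun x : EuclideanSpace ℝ (Fin n) => |x i|).rpow_const
      fun _ => Or.inr hq.le
  exact (continuous_finsetSum _ fun i _ => h i).rpow_const fun _ => Or.inr (by positivity)

theorem pnorm_rpow (hq : 0 < q) (x : EuclideanSpace ℝ (Fin n)) :
    pnorm q x ^ q = ∑ i, |x i| ^ q := by
  rw [pnorm, ← Real.rpow_mul (by positivity), one_div_mul_cancel hq.ne', Real.rpow_one]

theorem pnorm_smul (hq : 0 < q) (t : ℝ) (x : EuclideanSpace ℝ (Fin n)) :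
    pnorm q (t • x) = |t| * pnorm q x := by
  simp only [pnorm, PiLp.smul_apply, smul_eq_mul, abs_mul]
  rw [Finset.sum_congr rfl fun i _ => Real.mul_rpow (abs_nonneg t) (abs_nonneg (x i)),
    ← Finset.mul_sum, Real.mul_rpow (by positivity) (by positivity),
    ← Real.rpow_mul (abs_nonneg t), mul_one_div_cancel hq.ne', Real.rpow_one]

theorem abs_apply_le_pnorm (hq : 0 < q) (x : EuclideanSpace ℝ (Fin n)) (i : Fin n) :
    |x i| ≤ pnorm q x := by
  rw [← Real.rpow_le_rpow_iff (abs_nonneg _) (pnorm_nonneg x) hq, pnorm_rpow hq]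
  exact Finset.single_le_sum (f := fun i => |x i| ^ q) (fun i _ => by positivity)
    (Finset.mem_univ i)

theorem pnorm_eq_zero (hq : 0 < q) {x : EuclideanSpace ℝ (Fin n)} :
    pnorm q x = 0 ↔ x = 0 := by
  constructor
  · intro h
    ext i
    have := abs_apply_le_pnorm hq x i
    rw [h] at this
    simpa using this
  · rintro rfl
    simpa using pnorm_smul hq 0 (0 : EuclideanSpace ℝ (Fin n))

theorem pnorm_pos (hq : 0 < q) {x : EuclideanSpace ℝ (Fin n)} (hx : x ≠ 0) : 0 < pnorm q x :=
  (pnorm_nonneg x).lt_of_ne fun h => hx ((pnorm_eq_zero hq).1 h.symm)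

theorem pnorm_two (x : EuclideanSpace ℝ (Fin n)) : pnorm 2 x = ‖x‖ := by
  rw [EuclideanSpace.norm_eq, Real.sqrt_eq_rpow, pnorm]
  simp

theorem measurableSet_pBall (hq : 0 < q) : MeasurableSet (pBall n q) :=
  (isClosed_le (continuous_pnorm hq) continuous_const).measurableSet

theorem measurableSet_pSphere (hq : 0 < q) : MeasurableSet (pSphere n q) :=
  (isClosed_eq (continuous_pnorm hq) continuous_const).measurableSet

theorem volume_pBall_ne_zero (hq : 0 < q) : volume (pBall n q) ≠ 0 := by
  have ho : IsOpen {x : EuclideanSpace ℝ (Fin n) | pnorm q x < 1} :=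
    isOpen_lt (continuous_pnorm hq) continuous_const
  have h0 : (0 : EuclideanSpace ℝ (Fin n)) ∈ {x | pnorm q x < 1} := by
    rw [mem_ofPred_eq, (pnorm_eq_zero hq).2 rfl]; exact one_pos
  exact ((ho.measure_pos volume ⟨0, h0⟩).trans_le
    (measure_mono fun x hx => (le_of_lt hx : pnorm q x ≤ 1))).ne'

theorem volume_pBall_ne_top (hq : 0 < q) : volume (pBall n q) ≠ ∞ := by
  have : pBall n q ⊆ Metric.closedBall 0 (Real.sqrt n) := by
    intro x hx
    rw [mem_closedBall_zero_iff, EuclideanSpace.norm_eq]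
    refine Real.sqrt_le_sqrt ?_
    calc ∑ i, ‖x i‖ ^ 2 ≤ ∑ _i : Fin n, (1 : ℝ) := by
          refine Finset.sum_le_sum fun i _ => pow_le_one₀ (norm_nonneg _) ?_
          exact (abs_apply_le_pnorm hq x i).trans hx
      _ = n := by simp
  exact ((measure_mono this).trans_lt measure_closedBall_lt_top).ne

theorem isProbabilityMeasure_nuMeasure (hq : 0 < q) :
    IsProbabilityMeasure (nuMeasure n q) := by
  constructor
  rw [nuMeasure, Measure.smul_apply, Measure.restrict_apply_univ, smul_eq_mul,
    ENNReal.inv_mul_cancel (volume_pBall_ne_zero hq) (volume_pBall_ne_top hq)]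

theorem nuMeasure_apply (A : Set (EuclideanSpace ℝ (Fin n))) (hq : 0 < q) :
    nuMeasure n q A = volume (A ∩ pBall n q) / volume (pBall n q) := by
  rw [nuMeasure, Measure.smul_apply, Measure.restrict_apply' (measurableSet_pBall hq),
    smul_eq_mul, ENNReal.div_eq_inv_mul]

open Pointwise in
theorem smul_inter_pBall (hq : 0 < q) {C : Set (EuclideanSpace ℝ (Fin n))}
    (hC : ∀ t : ℝ, 0 < t → ∀ x, t • x ∈ C ↔ x ∈ C) {R : ℝ} (hR : 0 < R) :
    R • (C ∩ pBall n q) = C ∩ {x | pnorm q x ≤ R} := by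
  ext x
  rw [Set.mem_smul_set_iff_inv_smul_mem₀ hR.ne']
  simp only [mem_inter_iff, hC _ (inv_pos.2 hR), pBall, mem_ofPred_eq, pnorm_smul hq,
    abs_of_pos (inv_pos.2 hR)]
  rw [inv_mul_le_iff₀ hR, mul_one]

open Pointwise in
theorem volume_inter_pnorm_le (hq : 0 < q) {C : Set (EuclideanSpace ℝ (Fin n))}
    (hC : ∀ t : ℝ, 0 < t → ∀ x, t • x ∈ C ↔ x ∈ C) {R : ℝ} (hR : 0 < R) :
    volume (C ∩ {x | pnorm q x ≤ R}) = ENNReal.ofReal (R ^ n) * volume (C ∩ pBall n q) := by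
  rw [← smul_inter_pBall hq hC hR, Measure.addHaar_smul, finrank_euclideanSpace_fin,
    abs_of_pos (by positivity)]

end PNorm

section Density

theorem pi_withDensity_ofReal {ι : Type*} [Fintype ι] {g : ℝ → ℝ} (hg0 : ∀ x, 0 ≤ g x)
    (hgi : Integrable g) :
    Measure.pi (fun _ : ι => (volume : Measure ℝ).withDensity fun x => ENNReal.ofReal (g x)) =
      (volume : Measure (ι → ℝ)).withDensity fun x => ENNReal.ofReal (∏ i, g (x i)) := by
  have hsf : IsFiniteMeasure ((volume : Measure ℝ).withDensity fun x => ENNReal.ofReal (g x)) :=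
    isFiniteMeasure_withDensity_ofReal hgi.2
  refine Measure.pi_eq fun s hs => ?_
  have hind : ∀ i, Integrable ((s i).indicator g) := fun i => hgi.indicator (hs i)
  rw [withDensity_apply _ (MeasurableSet.univ_pi hs),
    ← lintegral_indicator (MeasurableSet.univ_pi hs)]
  have e : ∀ x : ι → ℝ, (univ.pi s).indicator (fun x => ENNReal.ofReal (∏ i, g (x i))) x =
      ENNReal.ofReal (∏ i, (s i).indicator g (x i)) := by
    intro x
    by_cases hx : x ∈ univ.pi s
    · rw [indicator_of_mem hx]
      congr 1
      exact Finset.prod_congr rfl fun i _ => (indicator_of_mem (hx i (mem_univ i)) g).symm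
    · rw [indicator_of_notMem hx]
      simp only [Set.mem_pi, mem_univ, true_implies, not_forall] at hx
      obtain ⟨i, hi⟩ := hx
      rw [Finset.prod_eq_zero (Finset.mem_univ i) (indicator_of_notMem hi g), ENNReal.ofReal_zero]
  simp_rw [e]
  have hnn : ∀ i x, 0 ≤ (s i).indicator g x := fun i x => indicator_nonneg (fun y _ => hg0 y) x
  rw [← ofReal_integral_eq_lintegral_ofReal (volume_pi (ι := ι) (α := fun _ => ℝ) ▸
    Integrable.fintype_prod hind)
    (ae_of_all _ fun x => Finset.prod_nonneg fun i _ => hnn i _),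
    integral_fintype_prod_volume_eq_prod (fun i => (s i).indicator g),
    ENNReal.ofReal_prod_of_nonneg fun i _ => integral_nonneg (hnn i)]
  refine Finset.prod_congr rfl fun i _ => ?_
  rw [withDensity_apply _ (hs i), integral_indicator (hs i),
    ofReal_integral_eq_lintegral_ofReal hgi.integrableOn (ae_of_all _ hg0)]

/-- The law of a vector in `ℝ^n` with i.i.d. coordinates distributed as `expPowLaw q`. -/
noncomputable def iidLaw (n : ℕ) (q : ℝ) : Measure (EuclideanSpace ℝ (Fin n)) :=
  (Measure.pi fun _ : Fin n => expPowLaw q).map (WithLp.toLp 2)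

theorem isProbabilityMeasure_iidLaw {n : ℕ} {q : ℝ} (hq : 0 < q) :
    IsProbabilityMeasure (iidLaw n q) := by
  have := isProbabilityMeasure_expPowLaw hq
  exact Measure.isProbabilityMeasure_map (by fun_prop)

theorem exists_iidLaw_eq_withDensity {n : ℕ} {q : ℝ} (hq : 0 < q) :
    ∃ Z : ℝ, 0 < Z ∧ iidLaw n q = volume.withDensity fun x =>
      ENNReal.ofReal (Z * Real.exp (-(pnorm q x ^ q / q))) := by
  set c := ∫ x : ℝ, Real.exp (-(|x| ^ q / q)) with hc
  have hi := integrable_exp_neg_abs_rpow_div hq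
  have hc0 : 0 < c := integral_exp_pos hi
  refine ⟨(c ^ n)⁻¹, by positivity, ?_⟩
  have h1 : Measure.pi (fun _ : Fin n => expPowLaw q) = _ :=
    pi_withDensity_ofReal (ι := Fin n) (g := fun x => Real.exp (-(|x| ^ q / q)) / c)
      (fun x => by positivity) (hi.div_const c)
  have hmp := PiLp.volume_preserving_toLp (Fin n)
  rw [iidLaw, h1]
  ext A hA
  rw [Measure.map_apply (by fun_prop) hA, withDensity_apply _ (hmp.measurable hA),
    withDensity_apply _ hA, ← hmp.setLIntegral_comp_preimage hA (by
      have := (continuous_pnorm (n := n) hq).measurable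
      fun_prop)]
  refine lintegral_congr fun x => ?_
  congr 1
  rw [Finset.prod_div_distrib, Finset.prod_const, Finset.card_fin, ← Real.exp_sum, pnorm_rpow hq,
    div_eq_inv_mul, Finset.sum_neg_distrib, Finset.sum_div]

theorem iidLaw_apply_of_cone {n : ℕ} (hn : 0 < n) {q : ℝ} (hq : 0 < q)
    {C : Set (EuclideanSpace ℝ (Fin n))} (hCm : MeasurableSet C)
    (hC : ∀ t : ℝ, 0 < t → ∀ x, t • x ∈ C ↔ x ∈ C) :
    iidLaw n q C = nuMeasure n q C := by
  have : Nonempty (Fin n) := ⟨⟨0, hn⟩⟩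
  obtain ⟨Z, hZ, hdens⟩ := exists_iidLaw_eq_withDensity (n := n) hq
  have := isProbabilityMeasure_iidLaw (n := n) hq
  set M := ∫⁻ t in Ioo (0 : ℝ) Z, ENNReal.ofReal (((q * Real.log (Z / t)) ^ (1 / q)) ^ n)
  have hmeas : Measurable fun x : EuclideanSpace ℝ (Fin n) =>
      Z * Real.exp (-(pnorm q x ^ q / q)) := by
    have := (continuous_pnorm (n := n) hq).measurable
    fun_prop
  have key : ∀ D : Set (EuclideanSpace ℝ (Fin n)), MeasurableSet D →
      (∀ t : ℝ, 0 < t → ∀ x, t • x ∈ D ↔ x ∈ D) →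
      iidLaw n q D = M * volume (D ∩ pBall n q) := by
    intro D hDm hD
    rw [hdens, withDensity_apply _ hDm, lintegral_eq_lintegral_meas_le _
      (ae_of_all _ fun x => by positivity) hmeas.aemeasurable]
    have e : ∀ᵐ t ∂volume.restrict (Ioi (0 : ℝ)), (volume.restrict D)
        {x | t ≤ Z * Real.exp (-(pnorm q x ^ q / q))} =
        (Ioo (0 : ℝ) Z).indicator
          (fun t => ENNReal.ofReal (((q * Real.log (Z / t)) ^ (1 / q)) ^ n)) t *
          volume (D ∩ pBall n q) := by
      rw [ae_restrict_iff' measurableSet_Ioi]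
      have hne : ∀ᵐ t : ℝ, t ≠ Z := by simp [ae_iff, measure_singleton]
      filter_upwards [hne] with t htZ ht0
      have ht0 : 0 < t := ht0
      rw [Measure.restrict_apply' hDm, inter_comm]
      rcases lt_or_gt_of_ne htZ with h | h
      · rw [indicator_of_mem (show t ∈ Ioo 0 Z from ⟨ht0, h⟩)]
        have hl : 0 < Real.log (Z / t) := Real.log_pos (by rwa [one_lt_div ht0])
        rw [← volume_inter_pnorm_le hq hD (by positivity)]
        congr 1
        ext x
        simp only [mem_inter_iff, mem_ofPred_eq]
        refine and_congr_right fun _ => ?_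
        rw [← Real.rpow_le_rpow_iff (z := q) (pnorm_nonneg x) (by positivity) hq,
          ← Real.rpow_mul (by positivity), one_div_mul_cancel hq.ne', Real.rpow_one,
          ← div_le_iff₀' hq, Real.le_log_iff_exp_le (by positivity), le_div_iff₀ ht0,
          Real.exp_neg, ← div_eq_mul_inv, le_div_iff₀ (Real.exp_pos _), mul_comm]
      · rw [indicator_of_notMem fun h' => h.not_gt h'.2, zero_mul]
        convert measure_empty (μ := volume)
        rw [eq_empty_iff_forall_notMem]
        rintro x ⟨-, hx⟩
        have h1 : Real.exp (-(pnorm q x ^ q / q)) ≤ 1 := by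
          rw [Real.exp_le_one_iff, neg_nonpos]
          have := pnorm_nonneg (q := q) x
          positivity
        have h2 : t ≤ Z * Real.exp (-(pnorm q x ^ q / q)) := hx
        nlinarith
    rw [lintegral_congr_ae e, lintegral_mul_const _ (by measurability),
      lintegral_indicator measurableSet_Ioo, Measure.restrict_restrict measurableSet_Ioo,
      inter_eq_left.2 (Ioo_subset_Ioi_self : Ioo 0 Z ⊆ Ioi 0)]
  have hu := key univ MeasurableSet.univ (by simp)
  rw [measure_univ, univ_inter] at hu
  rw [key C hCm hC, nuMeasure_apply _ hq,
    ENNReal.eq_div_iff (volume_pBall_ne_zero hq) (volume_pBall_ne_top hq), ← mul_assoc,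
    mul_comm _ M, ← hu, one_mul]

end Density

section ConeLaw

variable {n : ℕ} {q : ℝ}

/-- Radial projection onto the unit sphere of the `q`-norm. -/
noncomputable def pNormalize (q : ℝ) (x : EuclideanSpace ℝ (Fin n)) : EuclideanSpace ℝ (Fin n) :=
  (pnorm q x)⁻¹ • x

theorem measurable_pNormalize (hq : 0 < q) :
    Measurable (pNormalize q : EuclideanSpace ℝ (Fin n) → _) :=
  (continuous_pnorm hq).measurable.inv.smul measurable_id

theorem pNormalize_smul (hq : 0 < q) {t : ℝ} (ht : 0 < t) (x : EuclideanSpace ℝ (Fin n)) :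
    pNormalize q (t • x) = pNormalize q x := by
  rw [pNormalize, pnorm_smul hq, abs_of_pos ht, smul_smul, mul_inv, mul_right_comm,
    inv_mul_cancel₀ ht.ne', one_mul, pNormalize]

theorem pnorm_smul_pNormalize (hq : 0 < q) (x : EuclideanSpace ℝ (Fin n)) :
    pnorm q x • pNormalize q x = x := by
  rcases eq_or_ne x 0 with rfl | hx
  · simp [pNormalize]
  · rw [pNormalize, smul_smul, mul_inv_cancel₀ (pnorm_pos hq hx).ne', one_smul]

theorem pnorm_pNormalize (hq : 0 < q) {x : EuclideanSpace ℝ (Fin n)} (hx : x ≠ 0) :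
    pnorm q (pNormalize q x) = 1 := by
  have := pnorm_pos hq hx
  rw [pNormalize, pnorm_smul hq, abs_of_pos (inv_pos.2 this), inv_mul_cancel₀ this.ne']

/-- The cone probability measure, as the law of a normalized vector with i.i.d. coordinates. -/
noncomputable def coneLaw (n : ℕ) (q : ℝ) : Measure (EuclideanSpace ℝ (Fin n)) :=
  (iidLaw n q).map (pNormalize q)

theorem isProbabilityMeasure_coneLaw (hq : 0 < q) : IsProbabilityMeasure (coneLaw n q) :=
  have := isProbabilityMeasure_iidLaw (n := n) hq
  Measure.isProbabilityMeasure_map (measurable_pNormalize hq).aemeasurable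

theorem coneLaw_apply (hn : 0 < n) (hq : 0 < q) {A : Set (EuclideanSpace ℝ (Fin n))}
    (hA : MeasurableSet A) : coneLaw n q A = nuMeasure n q (pNormalize q ⁻¹' A) := by
  rw [coneLaw, Measure.map_apply (measurable_pNormalize hq) hA]
  refine iidLaw_apply_of_cone hn hq (measurable_pNormalize hq hA) fun t ht x => ?_
  rw [mem_preimage, pNormalize_smul hq ht, mem_preimage]

theorem coneSet_ae_eq (hn : 0 < n) (hq : 0 < q) {A : Set (EuclideanSpace ℝ (Fin n))}
    (hA : A ⊆ pSphere n q) :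
    coneSet A =ᵐ[volume] (pNormalize q ⁻¹' A ∩ pBall n q : Set (EuclideanSpace ℝ (Fin n))) := by
  have : Nonempty (Fin n) := ⟨⟨0, hn⟩⟩
  have hne : ∀ᵐ x : EuclideanSpace ℝ (Fin n), x ≠ 0 := by simp [ae_iff, measure_singleton]
  filter_upwards [hne] with x hx
  refine propext ⟨?_, ?_⟩
  · rintro ⟨t, ht, y, hy, rfl⟩
    have ht0 : 0 < t := ht.1.lt_of_ne fun h => hx (by simp [← h])
    have hy1 : pnorm q y = 1 := hA hy
    refine ⟨?_, ?_⟩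
    · change pNormalize q (t • y) ∈ A
      rw [pNormalize_smul hq ht0, pNormalize, hy1, inv_one, one_smul]
      exact hy
    · change pnorm q (t • y) ≤ 1
      rw [pnorm_smul hq, hy1, mul_one, abs_of_pos ht0]
      exact ht.2
  · rintro ⟨h1, h2⟩
    exact ⟨pnorm q x, ⟨pnorm_nonneg x, h2⟩, _, h1, pnorm_smul_pNormalize hq x⟩

theorem IsConeMeasure.eq_coneLaw (hn : 0 < n) (hq : 0 < q)
    {μ : Measure (EuclideanSpace ℝ (Fin n))} (hμ : IsConeMeasure n q μ) : μ = coneLaw n q := by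
  have : Nonempty (Fin n) := ⟨⟨0, hn⟩⟩
  ext A hA
  have hS := measurableSet_pSphere (n := n) hq
  have hne : ∀ᵐ x : EuclideanSpace ℝ (Fin n), x ≠ 0 := by simp [ae_iff, measure_singleton]
  rw [← measure_inter_conull hμ.2, hμ.1 _ (hA.inter hS) inter_subset_right,
    measure_congr (coneSet_ae_eq hn hq inter_subset_right), coneLaw_apply hn hq hA,
    nuMeasure_apply _ hq]
  congr 1
  refine measure_congr ?_
  filter_upwards [hne] with x hx
  refine propext (and_congr_left fun _ => and_iff_left ?_)
  exact pnorm_pNormalize hq hx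

theorem coneLaw_compl_pSphere (hn : 0 < n) (hq : 0 < q) :
    coneLaw n q (pSphere n q)ᶜ = 0 := by
  have : Nonempty (Fin n) := ⟨⟨0, hn⟩⟩
  rw [coneLaw_apply hn hq (measurableSet_pSphere hq).compl, nuMeasure_apply _ hq,
    measure_mono_null (t := {0}) ?_ (measure_singleton _), ENNReal.zero_div]
  rintro x ⟨hx, -⟩
  by_contra h
  exact hx (pnorm_pNormalize hq h)

end ConeLaw

section SphereUniform

theorem lipschitzOnWith_inv_norm_smul {E : Type*} [NormedAddCommGroup E] [NormedSpace ℝ E] :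
    LipschitzOnWith 2 (fun x : E => ‖x‖⁻¹ • x) {x | 1 ≤ ‖x‖} := by
  refine LipschitzOnWith.of_dist_le_mul fun x hx y hy => ?_
  have hx1 : 1 ≤ ‖x‖ := hx
  have hy1 : 1 ≤ ‖y‖ := hy
  have hx0 : 0 < ‖x‖ := by linarith
  have hy0 : 0 < ‖y‖ := by linarith
  have e : ‖x‖⁻¹ • x - ‖y‖⁻¹ • y = ‖x‖⁻¹ • (x - y) + (‖x‖⁻¹ - ‖y‖⁻¹) • y := by
    rw [smul_sub, sub_smul]; abel
  have h1 : ‖‖x‖⁻¹ • (x - y)‖ ≤ ‖x - y‖ := by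
    rw [norm_smul, norm_inv, norm_norm]
    exact mul_le_of_le_one_left (norm_nonneg _) (inv_le_one_of_one_le₀ hx1)
  have h2 : ‖(‖x‖⁻¹ - ‖y‖⁻¹) • y‖ ≤ ‖x - y‖ := by
    have : ‖x‖⁻¹ - ‖y‖⁻¹ = (‖y‖ - ‖x‖) * (‖x‖⁻¹ * ‖y‖⁻¹) := by field_simp
    rw [norm_smul, this, norm_mul, norm_mul, norm_inv, norm_inv, norm_norm, norm_norm,
      mul_assoc, mul_assoc, inv_mul_cancel₀ hy0.ne', mul_one, Real.norm_eq_abs, abs_sub_comm]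
    exact (mul_le_of_le_one_right (abs_nonneg _) (inv_le_one_of_one_le₀ hx1)).trans
      (abs_norm_sub_norm_le x y)
  rw [dist_eq_norm, dist_eq_norm, e]
  calc _ ≤ ‖‖x‖⁻¹ • (x - y)‖ + ‖(‖x‖⁻¹ - ‖y‖⁻¹) • y‖ := norm_add_le _ _
    _ ≤ ((2 : ℝ≥0) : ℝ) * ‖x - y‖ := by rw [NNReal.coe_ofNat]; linarith

theorem exists_lipschitzWith_toLp_insertNth (m : ℕ) :
    ∃ K : ℝ≥0, ∀ (i : Fin (m + 1)) (s : ℝ), LipschitzWith K fun y : Fin m → ℝ =>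
      (WithLp.toLp 2 (i.insertNth s y : Fin (m + 1) → ℝ) : EuclideanSpace ℝ (Fin (m + 1))) := by
  refine ⟨_, fun i s => (PiLp.lipschitzWith_toLp 2 fun _ : Fin (m + 1) => ℝ).comp
    (LipschitzWith.of_dist_le_mul (K := 1) fun y z => ?_)⟩
  rw [NNReal.coe_one, one_mul, dist_pi_le_iff dist_nonneg, Fin.forall_iff_succAbove i]
  simp only [Fin.insertNth_apply_same, dist_self, dist_nonneg, Fin.insertNth_apply_succAbove,
    true_and]
  exact fun j => dist_le_pi_dist y z j

theorem sphere_subset_iUnion_image (m : ℕ) :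
    Metric.sphere (0 : EuclideanSpace ℝ (Fin (m + 1))) 1 ⊆
      ⋃ i : Fin (m + 1), ⋃ b : Bool, (fun y : Fin m → ℝ => (fun x => ‖x‖⁻¹ • x)
        (WithLp.toLp 2 (i.insertNth (cond b 1 (-1)) y : Fin (m + 1) → ℝ) :
          EuclideanSpace ℝ (Fin (m + 1)))) '' Icc (-1) 1 := by
  intro x hx
  have hx1 : ‖x‖ = 1 := by simpa using hx
  obtain ⟨i, hi⟩ := Finite.exists_max fun j => |x j|
  have hM : 0 < |x i| := by
    by_contra h
    have hx0 : x = 0 := by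
      ext j
      have := (hi j).trans (not_lt.1 h)
      simpa using this
    rw [hx0, norm_zero] at hx1
    exact zero_ne_one hx1
  obtain ⟨b, hb⟩ : ∃ b : Bool, x i = |x i| * cond b 1 (-1) := by
    rcases le_total 0 (x i) with h | h
    · exact ⟨true, by simp [abs_of_nonneg h]⟩
    · exact ⟨false, by simp [abs_of_nonpos h]⟩
  refine mem_iUnion.2 ⟨i, mem_iUnion.2 ⟨b, fun j => |x i|⁻¹ * x (i.succAbove j), ?_, ?_⟩⟩
  · rw [mem_Icc, Pi.le_def, Pi.le_def, ← forall_and]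
    intro j
    have h := hi (i.succAbove j)
    rw [← div_le_one hM, div_eq_inv_mul, ← abs_of_pos (inv_pos.2 hM), ← abs_mul, abs_le] at h
    exact h
  · have e : (WithLp.toLp 2 (i.insertNth (cond b 1 (-1)) fun j => |x i|⁻¹ * x (i.succAbove j) :
        Fin (m + 1) → ℝ) : EuclideanSpace ℝ (Fin (m + 1))) = |x i|⁻¹ • x := by
      ext k
      simp only [PiLp.smul_apply, smul_eq_mul]
      rcases Fin.eq_self_or_eq_succAbove i k with rfl | ⟨j, rfl⟩
      · rw [Fin.insertNth_apply_same, eq_inv_mul_iff_mul_eq₀ hM.ne']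
        exact hb.symm
      · rw [Fin.insertNth_apply_succAbove]
    simp only [e]
    rw [norm_smul, norm_inv, Real.norm_eq_abs, abs_abs, hx1, mul_one, inv_inv, smul_smul,
      mul_inv_cancel₀ hM.ne', one_smul]

theorem hausdorffMeasure_sphere_ne_top (m : ℕ) :
    μH[(m : ℝ)] (Metric.sphere (0 : EuclideanSpace ℝ (Fin (m + 1))) 1) ≠ ∞ := by
  obtain ⟨K, hK⟩ := exists_lipschitzWith_toLp_insertNth m
  refine ((measure_mono (sphere_subset_iUnion_image m)).trans_lt ?_).ne
  refine (measure_iUnion_fintype_le _ _).trans_lt (ENNReal.sum_lt_top.2 fun i _ => ?_)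
  refine (measure_iUnion_fintype_le _ _).trans_lt (ENNReal.sum_lt_top.2 fun b _ => ?_)
  have hlip := (lipschitzOnWith_inv_norm_smul (E := EuclideanSpace ℝ (Fin (m + 1)))).comp
    ((hK i (cond b 1 (-1))).lipschitzOnWith (s := Icc (-1) 1)) fun y _ => by
      rw [mem_ofPred_eq]
      refine le_trans ?_ (PiLp.norm_apply_le _ i)
      cases b <;> simp
  refine (hlip.hausdorffMeasure_image_le m.cast_nonneg).trans_lt ?_
  have h := hausdorffMeasure_pi_real (ι := Fin m)
  rw [Fintype.card_fin] at h
  rw [h]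
  exact ENNReal.mul_lt_top (ENNReal.rpow_lt_top_of_nonneg m.cast_nonneg ENNReal.coe_ne_top)
    isCompact_Icc.measure_lt_top

theorem hausdorffMeasure_sphere_ne_zero (m : ℕ) :
    μH[(m : ℝ)] (Metric.sphere (0 : EuclideanSpace ℝ (Fin (m + 1))) 1) ≠ 0 := by
  intro h0
  have hlip : LipschitzWith 1 fun (x : EuclideanSpace ℝ (Fin (m + 1))) (j : Fin m) => x j.succ := by
    refine LipschitzWith.of_dist_le_mul fun x y => ?_
    rw [NNReal.coe_one, one_mul, dist_pi_le_iff dist_nonneg]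
    intro j
    rw [Real.dist_eq, dist_eq_norm]
    exact PiLp.norm_apply_le (x - y) j.succ
  have hle := hlip.hausdorffMeasure_image_le m.cast_nonneg
    (Metric.sphere (0 : EuclideanSpace ℝ (Fin (m + 1))) 1)
  have h := hausdorffMeasure_pi_real (ι := Fin m)
  rw [Fintype.card_fin] at h
  rw [h0, mul_zero, h] at hle
  have ho : IsOpen {y : Fin m → ℝ | ∑ j, y j ^ 2 < 1} :=
    isOpen_lt (by fun_prop) continuous_const
  refine (ho.measure_pos volume ⟨0, by simp⟩).ne' (measure_mono_null ?_ (le_zero_iff.1 hle))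
  intro y hy
  have hy1 : ∑ j, y j ^ 2 < 1 := hy
  refine ⟨WithLp.toLp 2 (Fin.cons (Real.sqrt (1 - ∑ j, y j ^ 2)) y), ?_, ?_⟩
  · rw [mem_sphere_zero_iff_norm, EuclideanSpace.norm_eq, Fin.sum_univ_succ]
    simp [Real.sq_sqrt (sub_nonneg.2 hy1.le)]
  · ext j
    simp

theorem sphereUniform_succ_isProbabilityMeasure (m : ℕ) :
    IsProbabilityMeasure (sphereUniform (m + 1)) := by
  constructor
  have : ((m + 1 : ℕ) : ℝ) - 1 = m := by push_cast; ring
  rw [sphereUniform, Measure.smul_apply, Measure.restrict_apply_univ, smul_eq_mul, this,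
    ENNReal.inv_mul_cancel (hausdorffMeasure_sphere_ne_zero m) (hausdorffMeasure_sphere_ne_top m)]

variable {n : ℕ}

theorem sphereUniform_map_isometry (L : EuclideanSpace ℝ (Fin n) ≃ₗᵢ[ℝ] EuclideanSpace ℝ (Fin n)) :
    (sphereUniform n).map L = sphereUniform n := by
  have hL : Measurable L := L.continuous.measurable
  have hS : L ⁻¹' Metric.sphere 0 1 = Metric.sphere 0 1 := by
    ext x; simp
  rw [sphereUniform, Measure.map_smul]
  congr 1
  nth_rw 1 [← hS]
  rw [← Measure.restrict_map hL Metric.isClosed_sphere.measurableSet]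
  congr 1
  exact L.toIsometryEquiv.map_hausdorffMeasure _

theorem coneLaw_two_map_isometry (hn : 0 < n)
    (L : EuclideanSpace ℝ (Fin n) ≃ₗᵢ[ℝ] EuclideanSpace ℝ (Fin n)) :
    (coneLaw n 2).map L = coneLaw n 2 := by
  have hL : Measurable L := L.continuous.measurable
  ext A hA
  rw [Measure.map_apply hL hA, coneLaw_apply hn two_pos (hL hA), coneLaw_apply hn two_pos hA,
    nuMeasure_apply _ two_pos, nuMeasure_apply _ two_pos,
    ← L.measurePreserving.measure_preimage ((measurable_pNormalize two_pos hA).inter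
      (measurableSet_pBall two_pos)).nullMeasurableSet]
  congr 2
  ext x
  simp only [mem_inter_iff, mem_preimage, pNormalize, pBall, mem_ofPred_eq, pnorm_two,
    LinearIsometryEquiv.norm_map, map_smul]

theorem charFun_eq_of_norm_eq {E : Type*} [NormedAddCommGroup E] [InnerProductSpace ℝ E]
    [FiniteDimensional ℝ E] [MeasurableSpace E] [BorelSpace E] {σ : Measure E}
    (hσ : ∀ L : E ≃ₗᵢ[ℝ] E, σ.map L = σ) {s t : E} (h : ‖s‖ = ‖t‖) :
    charFun σ s = charFun σ t := by
  set L := (Submodule.span ℝ {s - t})ᗮ.reflection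
  have hs : L s = t := Submodule.reflection_sub h
  have h1 : charFun (σ.map L) (L s) = charFun σ s := by
    rw [charFun_apply, integral_map L.continuous.measurable.aemeasurable (by fun_prop),
      charFun_apply]
    simp only [LinearIsometryEquiv.inner_map_map]
  rw [← h1, hσ, hs]

/-- A rotation-invariant probability measure on the unit sphere is unique. -/
theorem eq_of_rotation_invariant {E : Type*} [NormedAddCommGroup E] [InnerProductSpace ℝ E]
    [FiniteDimensional ℝ E] [MeasurableSpace E] [BorelSpace E] {σ τ : Measure E}
    [IsProbabilityMeasure σ] [IsProbabilityMeasure τ]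
    (hσ : ∀ L : E ≃ₗᵢ[ℝ] E, σ.map L = σ) (hτ : ∀ L : E ≃ₗᵢ[ℝ] E, τ.map L = τ)
    (hσ1 : ∀ᵐ x ∂σ, ‖x‖ = 1) (hτ1 : ∀ᵐ x ∂τ, ‖x‖ = 1) : σ = τ := by
  refine Measure.ext_of_charFun (funext fun t => ?_)
  have key : ∀ (μ ν : Measure E) [IsProbabilityMeasure μ] [IsProbabilityMeasure ν],
      (∀ L : E ≃ₗᵢ[ℝ] E, μ.map L = μ) → (∀ᵐ x ∂ν, ‖x‖ = 1) →
      charFun μ t = ∫ y, ∫ x, Complex.exp ((inner ℝ x y * ‖t‖ : ℝ) * Complex.I) ∂μ ∂ν := by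
    intro μ ν _ _ hμ hν
    have : ∀ᵐ y ∂ν, ∫ x, Complex.exp ((inner ℝ x y * ‖t‖ : ℝ) * Complex.I) ∂μ = charFun μ t := by
      filter_upwards [hν] with y hy
      rw [charFun_eq_of_norm_eq (t := ‖t‖ • y) hμ (by rw [norm_smul, hy, norm_norm, mul_one]),
        charFun_apply]
      simp only [inner_smul_right, mul_comm]
    rw [integral_congr_ae this]
    simp
  rw [key σ τ hσ hτ1, key τ σ hτ hσ1, integral_integral_swap]
  · simp only [real_inner_comm]
  · refine (integrable_const (1 : ℝ)).mono' ?_ (ae_of_all _ fun z => ?_)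
    · exact (by fun_prop : Continuous _).aestronglyMeasurable
    · simp only [Function.uncurry, Complex.norm_exp_ofReal_mul_I, le_refl]

theorem sphereUniform_eq_coneLaw (hn : 0 < n) : sphereUniform n = coneLaw n 2 := by
  obtain ⟨m, rfl⟩ := Nat.exists_eq_succ_of_ne_zero hn.ne'
  have := sphereUniform_succ_isProbabilityMeasure m
  have := isProbabilityMeasure_coneLaw (n := m + 1) two_pos
  refine eq_of_rotation_invariant sphereUniform_map_isometry (coneLaw_two_map_isometry hn) ?_ ?_
  · refine Measure.ae_smul_measure ?_ _
    filter_upwards [ae_restrict_mem Metric.isClosed_sphere.measurableSet] with x hx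
    simpa using hx
  · have h := coneLaw_compl_pSphere hn two_pos
    filter_upwards [measure_eq_zero_iff_ae_notMem.1 h] with x hx
    rw [← pnorm_two]
    exact not_not.1 hx

end SphereUniform

section Projection

variable {n : ℕ} {p : ℝ}

/-- The rescaled inner product `n ^ (1 / p - 1 / 2) ⟨x, θ⟩`. -/
noncomputable def projStat (p : ℝ) (n : ℕ)
    (z : EuclideanSpace ℝ (Fin n) × EuclideanSpace ℝ (Fin n)) : ℝ :=
  (n : ℝ) ^ (1 / p - 1 / 2) * ∑ i, z.1 i * z.2 i

theorem measurable_projStat : Measurable (projStat p n) := by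
  unfold projStat; fun_prop

theorem projStat_smul_left (t : ℝ) (x θ : EuclideanSpace ℝ (Fin n)) :
    projStat p n (t • x, θ) = t * projStat p n (x, θ) := by
  simp only [projStat, PiLp.smul_apply, smul_eq_mul, mul_assoc, ← Finset.mul_sum]
  ring

theorem map_projStat_coneLaw (hp : 0 < p) :
    ((coneLaw n p).prod (coneLaw n 2)).map (projStat p n) =
      (Measure.pi fun _ : Fin n => pairLaw p).map (normStat p n) := by
  have := isProbabilityMeasure_expPowLaw hp
  have := isProbabilityMeasure_expPowLaw two_pos
  have h := measurePreserving_arrowProdEquivProdArrow ℝ ℝ (Fin n) (fun _ => expPowLaw p)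
    (fun _ => expPowLaw 2)
  have hN := measurable_pNormalize (n := n) hp
  have hN₂ := measurable_pNormalize (n := n) two_pos
  have hT : Measurable (WithLp.toLp 2 : (Fin n → ℝ) → EuclideanSpace ℝ (Fin n)) := by fun_prop
  rw [coneLaw, coneLaw, iidLaw, iidLaw, Measure.map_map hN hT, Measure.map_map hN₂ hT,
    Measure.map_prod_map _ _ (hN.comp hT) (hN₂.comp hT), ← h.map_eq,
    Measure.map_map ((hN.comp hT).prodMap (hN₂.comp hT)) h.measurable,
    Measure.map_map measurable_projStat
      (((hN.comp hT).prodMap (hN₂.comp hT)).comp h.measurable)]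
  refine congrArg (fun f => Measure.map f _) (funext fun x => ?_)
  have e : ∀ (q : ℝ) (y : Fin n → ℝ) (i : Fin n), pNormalize q (WithLp.toLp 2 y) i =
      y i / (∑ i, |y i| ^ q) ^ (1 / q) := fun q y i => by
    rw [pNormalize, PiLp.smul_apply, smul_eq_mul, pnorm, div_eq_mul_inv (y i), mul_comm]
  simp only [Function.comp_apply, Prod.map, projStat, normStat, e]
  simp only [div_mul_div_comm, ← Finset.sum_div]
  rfl

theorem nuMeasure_projStat_ge_le (hn : 0 < n) (hp : 0 < p) (w : ℝ)
    (θ : EuclideanSpace ℝ (Fin n)) :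
    nuMeasure n p {x | w ≤ |projStat p n (x, θ)|} ≤
      coneLaw n p {x | w ≤ |projStat p n (x, θ)|} := by
  have hm : Measurable fun x => projStat p n (x, θ) := measurable_projStat.comp (by fun_prop)
  rw [coneLaw_apply hn hp (measurableSet_le measurable_const (by fun_prop)),
    nuMeasure_apply _ hp, nuMeasure_apply _ hp]
  refine ENNReal.div_le_div_right (measure_mono ?_) _
  rintro x ⟨hx, hB⟩
  refine ⟨?_, hB⟩
  have hx : w ≤ |projStat p n (x, θ)| := hx
  have hB : pnorm p x ≤ 1 := hB
  rw [← pnorm_smul_pNormalize hp x, projStat_smul_left, abs_mul,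
    abs_of_nonneg (pnorm_nonneg x)] at hx
  exact hx.trans (mul_le_of_le_one_left (abs_nonneg _) hB)

theorem nuMeasure_le_of_cone (hn : 0 < n) (hp : 0 < p) {C : Set (EuclideanSpace ℝ (Fin n))}
    (hC : ∀ t : ℝ, 0 < t → ∀ x, t • x ∈ C ↔ x ∈ C) {δ : ℝ} (hδ : 0 < δ) (hδ1 : δ < 1) :
    ENNReal.ofReal δ * nuMeasure n p C ≤ nuMeasure n p (C \ {x | pnorm p x ≤ 1 - δ}) := by
  have := isProbabilityMeasure_nuMeasure (n := n) hp
  have h1 : nuMeasure n p (C ∩ {x | pnorm p x ≤ 1 - δ}) ≤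
      ENNReal.ofReal (1 - δ) * nuMeasure n p C := by
    have e : C ∩ {x | pnorm p x ≤ 1 - δ} ∩ pBall n p = C ∩ {x | pnorm p x ≤ 1 - δ} :=
      inter_eq_left.2 fun x hx => (hx.2.trans (by linarith) : pnorm p x ≤ 1)
    rw [nuMeasure_apply _ hp, nuMeasure_apply _ hp, e, volume_inter_pnorm_le hp hC (by linarith),
      mul_div_assoc]
    gcongr
    exact pow_le_of_le_one (by linarith) (by linarith) hn.ne'
  have h2 : nuMeasure n p C =
      ENNReal.ofReal (1 - δ) * nuMeasure n p C + ENNReal.ofReal δ * nuMeasure n p C := by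
    rw [← add_mul, ← ENNReal.ofReal_add (by linarith) hδ.le, sub_add_cancel, ENNReal.ofReal_one,
      one_mul]
  have h3 : nuMeasure n p C ≤ ENNReal.ofReal (1 - δ) * nuMeasure n p C +
      nuMeasure n p (C \ {x | pnorm p x ≤ 1 - δ}) :=
    (measure_le_inter_add_sdiff _ _ _).trans (by gcongr)
  nth_rw 1 [h2] at h3
  exact (ENNReal.add_le_add_iff_left
    (ENNReal.mul_ne_top ENNReal.ofReal_ne_top (measure_ne_top _ _))).1 h3

theorem nuMeasure_projStat_near_ge (hn : 0 < n) (hp : 0 < p) {w η δ : ℝ}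
    (hδ : 0 < δ) (hδ1 : δ < 1) (hη : δ * (|w| + η / 2) < η / 2) (θ : EuclideanSpace ℝ (Fin n)) :
    ENNReal.ofReal δ * coneLaw n p {x | |projStat p n (x, θ) - w| < η / 2} ≤
      nuMeasure n p {x | |projStat p n (x, θ) - w| < η} := by
  have hm : Measurable fun x => projStat p n (x, θ) := measurable_projStat.comp (by fun_prop)
  rw [coneLaw_apply hn hp (measurableSet_lt (by fun_prop) measurable_const)]
  refine (nuMeasure_le_of_cone hn hp (fun t ht x => ?_) hδ hδ1).trans ?_
  · rw [mem_preimage, pNormalize_smul hp ht, mem_preimage]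
  rw [nuMeasure_apply _ hp, nuMeasure_apply _ hp]
  refine ENNReal.div_le_div_right (measure_mono ?_) _
  rintro x ⟨⟨hC, hδx⟩, hB⟩
  refine ⟨?_, hB⟩
  have hC : |projStat p n (pNormalize p x, θ) - w| < η / 2 := hC
  have hB : pnorm p x ≤ 1 := hB
  have hδx : 1 - δ < pnorm p x := not_le.1 hδx
  rw [mem_ofPred_eq, ← pnorm_smul_pNormalize hp x, projStat_smul_left]
  set s := projStat p n (pNormalize p x, θ)
  have hs : |s| < |w| + η / 2 := by
    have := abs_sub_abs_le_abs_sub s w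
    linarith
  have e : pnorm p x * s - w = (s - w) - (1 - pnorm p x) * s := by ring
  have h2 : |(1 - pnorm p x) * s| ≤ δ * (|w| + η / 2) := by
    rw [abs_mul, abs_of_nonneg (by linarith)]
    exact mul_le_mul (by linarith) hs.le (abs_nonneg _) hδ.le
  rw [e]
  linarith [abs_sub (s - w) ((1 - pnorm p x) * s)]

theorem measurableSet_abs_ge (w : ℝ) : MeasurableSet {t : ℝ | w ≤ |t|} :=
  measurableSet_le measurable_const (by fun_prop)

theorem measurableSet_abs_sub_lt (w η : ℝ) : MeasurableSet {t : ℝ | |t - w| < η} :=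
  measurableSet_lt (by fun_prop) measurable_const

theorem measurable_normStat : Measurable (normStat p n) := by
  unfold normStat; fun_prop

theorem map_projStat_ge_le (hn : 0 < n) (hp : 0 < p) {μ : Measure (EuclideanSpace ℝ (Fin n))}
    (hμ : μ = nuMeasure n p ∨ IsConeMeasure n p μ) (w : ℝ) :
    (μ.prod (sphereUniform n)).map (projStat p n) {t | w ≤ |t|} ≤
      Measure.pi (fun _ : Fin n => pairLaw p) {x | w ≤ |normStat p n x|} := by
  have := isProbabilityMeasure_nuMeasure (n := n) hp
  have := isProbabilityMeasure_coneLaw (n := n) hp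
  have := isProbabilityMeasure_coneLaw (n := n) two_pos
  have hA := measurableSet_abs_ge w
  have hcone : ((coneLaw n p).prod (coneLaw n 2)).map (projStat p n) {t | w ≤ |t|} =
      Measure.pi (fun _ : Fin n => pairLaw p) {x | w ≤ |normStat p n x|} := by
    rw [map_projStat_coneLaw hp, Measure.map_apply measurable_normStat hA]; rfl
  rw [sphereUniform_eq_coneLaw hn, ← hcone]
  rcases hμ with rfl | hμ
  · rw [Measure.map_apply measurable_projStat hA, Measure.map_apply measurable_projStat hA,
      Measure.prod_apply_symm (measurable_projStat hA),
      Measure.prod_apply_symm (measurable_projStat hA)]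
    exact lintegral_mono fun θ => nuMeasure_projStat_ge_le hn hp w θ
  · rw [hμ.eq_coneLaw hn hp]

theorem exists_map_projStat_near_ge (hp : 0 < p) (w : ℝ) {η : ℝ} (hη : 0 < η) :
    ∃ δ : ℝ, 0 < δ ∧ ∀ n : ℕ, 0 < n → ∀ μ : Measure (EuclideanSpace ℝ (Fin n)),
      (μ = nuMeasure n p ∨ IsConeMeasure n p μ) →
      ENNReal.ofReal δ *
        Measure.pi (fun _ : Fin n => pairLaw p) {x | |normStat p n x - w| < η / 2} ≤
      (μ.prod (sphereUniform n)).map (projStat p n) {t | |t - w| < η} := by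
  have hc : 0 < |w| + η / 2 := by positivity
  obtain ⟨δ, hδ, hδ'⟩ := exists_between (lt_min one_pos (by positivity :
    0 < η / 2 / (|w| + η / 2)))
  rw [lt_min_iff, lt_div_iff₀ hc] at hδ'
  refine ⟨δ, hδ, fun n hn μ hμ => ?_⟩
  have := isProbabilityMeasure_nuMeasure (n := n) hp
  have := isProbabilityMeasure_coneLaw (n := n) hp
  have := isProbabilityMeasure_coneLaw (n := n) two_pos
  have hcone : ((coneLaw n p).prod (coneLaw n 2)).map (projStat p n) {t | |t - w| < η / 2} =
      Measure.pi (fun _ : Fin n => pairLaw p) {x | |normStat p n x - w| < η / 2} := by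
    rw [map_projStat_coneLaw hp, Measure.map_apply measurable_normStat
      (measurableSet_abs_sub_lt _ _)]; rfl
  rw [sphereUniform_eq_coneLaw hn, ← hcone]
  rcases hμ with rfl | hμ
  · have hm := fun η => measurable_projStat (p := p) (n := n) (measurableSet_abs_sub_lt w η)
    rw [Measure.map_apply measurable_projStat (measurableSet_abs_sub_lt _ _),
      Measure.map_apply measurable_projStat (measurableSet_abs_sub_lt _ _),
      Measure.prod_apply_symm (hm _), Measure.prod_apply_symm (hm _),
      ← lintegral_const_mul _ (measurable_measure_prodMk_right (hm _))]
    exact lintegral_mono fun θ => nuMeasure_projStat_near_ge hn hp hδ hδ'.1 hδ'.2 θ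
  · rw [hμ.eq_coneLaw hn hp]
    exact (mul_le_of_le_one_left zero_le (ENNReal.ofReal_le_one.2 hδ'.1.le)).trans
      (measure_mono fun t (ht : |t - w| < η / 2) => (by linarith : |t - w| < η))

theorem expDecay_projStat (hp : 1 ≤ p) (hp2 : p < 2)
    {μX : (n : ℕ) → Measure (EuclideanSpace ℝ (Fin n))}
    (hμX : ∀ n, μX n = nuMeasure n p ∨ IsConeMeasure n p (μX n)) {w : ℝ} (hw : 0 < w) :
    ExpDecay (2 * p / (2 + p)) ((2 + p) / (2 * p) * w ^ (2 * p / (2 + p)))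
      (fun n => ((μX n).prod (sphereUniform n)).map (projStat p n) {t | w ≤ |t|}) := by
  refine (expDecay_normStat hp hp2 hw).of_eventually_le le_rfl ?_
  filter_upwards [eventually_gt_atTop 0] with n hn
  exact map_projStat_ge_le hn (by linarith) (hμX n) w

theorem eventually_projStat_near_ge (hp : 1 ≤ p) (hp2 : p < 2)
    {μX : (n : ℕ) → Measure (EuclideanSpace ℝ (Fin n))}
    (hμX : ∀ n, μX n = nuMeasure n p ∨ IsConeMeasure n p (μX n)) {w η κ : ℝ} (hw : w ≠ 0)
    (hη : 0 < η) (hκ : (2 + p) / (2 * p) * |w| ^ (2 * p / (2 + p)) < κ) :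
    ∀ᶠ n : ℕ in atTop, ENNReal.ofReal (Real.exp (-(κ * (n : ℝ) ^ (2 * p / (2 + p))))) ≤
      ((μX n).prod (sphereUniform n)).map (projStat p n) {t | |t - w| < η} := by
  have hp0 : 0 < p := by linarith
  obtain ⟨δ, hδ, hge⟩ := exists_map_projStat_near_ge hp0 w hη
  obtain ⟨κ', h1, h2⟩ := exists_between hκ
  have hr0 : 0 < 2 * p / (2 + p) := by positivity
  filter_upwards [eventually_normStat_near_ge hp hp2 hw (half_pos hη) h1, eventually_gt_atTop 0,
    (tendsto_natCast_rpow hr0).eventually_ge_atTop (-Real.log δ / (κ - κ'))] with n hn hn0 hn1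
  refine le_trans ?_ ((mul_le_mul_right hn (ENNReal.ofReal δ)).trans (hge n hn0 _ (hμX n)))
  rw [← ENNReal.ofReal_mul hδ.le]
  refine ENNReal.ofReal_le_ofReal ?_
  rw [div_le_iff₀ (by linarith)] at hn1
  calc Real.exp (-(κ * (n : ℝ) ^ (2 * p / (2 + p)))) ≤
      Real.exp (Real.log δ + -(κ' * (n : ℝ) ^ (2 * p / (2 + p)))) :=
        Real.exp_le_exp.2 (by linarith)
    _ = _ := by rw [Real.exp_add, Real.exp_log hδ]

end Projection

section LDP

theorem ennreal_log_ofReal_exp (y : ℝ) : ENNReal.log (ENNReal.ofReal (Real.exp y)) = y := by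
  rw [ENNReal.log_ofReal_of_pos (Real.exp_pos y), Real.log_exp]

theorem coe_inv_mul_neg_mul {S : ℝ} (hS : 0 < S) (κ : ℝ) :
    ((S⁻¹ : ℝ) : EReal) * ((-(κ * S) : ℝ) : EReal) = ((-κ : ℝ) : EReal) := by
  rw [← EReal.coe_mul]
  congr 1
  field_simp

theorem neg_le_inv_mul_log {S κ : ℝ} (hS : 0 < S) {m : ℝ≥0∞}
    (h : ENNReal.ofReal (Real.exp (-(κ * S))) ≤ m) :
    ((-κ : ℝ) : EReal) ≤ ((S⁻¹ : ℝ) : EReal) * ENNReal.log m := by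
  rw [← coe_inv_mul_neg_mul hS]
  exact mul_le_mul_of_nonneg_left
    ((ennreal_log_ofReal_exp _).symm.trans_le (ENNReal.log_monotone h))
    (EReal.coe_nonneg.2 (inv_nonneg.2 hS.le))

theorem inv_mul_log_le_neg {S κ : ℝ} (hS : 0 < S) {m : ℝ≥0∞}
    (h : m ≤ ENNReal.ofReal (Real.exp (-(κ * S)))) :
    ((S⁻¹ : ℝ) : EReal) * ENNReal.log m ≤ ((-κ : ℝ) : EReal) := by
  rw [← coe_inv_mul_neg_mul hS]
  exact mul_le_mul_of_nonneg_left
    ((ENNReal.log_monotone h).trans_eq (ennreal_log_ofReal_exp _))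
    (EReal.coe_nonneg.2 (inv_nonneg.2 hS.le))

variable {μ : ℕ → Measure ℝ} {c r s : ℝ}

theorem isCompact_powerRate_le (hc : 0 < c) (hr : 0 < r) (C : ℝ≥0) :
    IsCompact {x : ℝ | ENNReal.ofReal (c * |x| ^ r) ≤ (C : ℝ≥0∞)} := by
  have hcont : Continuous fun x : ℝ => ENNReal.ofReal (c * |x| ^ r) :=
    ENNReal.continuous_ofReal.comp
      (continuous_const.mul (continuous_abs.rpow_const fun _ => Or.inr hr.le))
  refine Metric.isCompact_of_isClosed_isBounded (isClosed_le hcont continuous_const)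
    ((Metric.isBounded_closedBall (x := (0 : ℝ)) (r := (C / c) ^ (1 / r))).subset ?_)
  intro x hx
  have hx : ENNReal.ofReal (c * |x| ^ r) ≤ (C : ℝ≥0∞) := hx
  rw [ENNReal.ofReal_le_coe, ← le_div_iff₀' hc] at hx
  rw [mem_closedBall_zero_iff, Real.norm_eq_abs]
  calc |x| = (|x| ^ r) ^ (1 / r) := by
        rw [← Real.rpow_mul (abs_nonneg x), mul_one_div_cancel hr.ne', Real.rpow_one]
    _ ≤ _ := by gcongr

theorem ldp_lower_bound (hr : 0 < r)
    (hlow : ∀ w : ℝ, w ≠ 0 → ∀ η > 0, ∀ κ, c * |w| ^ r < κ →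
      ∀ᶠ n : ℕ in atTop, ENNReal.ofReal (Real.exp (-(κ * (n : ℝ) ^ s))) ≤ μ n {t | |t - w| < η})
    (A : Set ℝ) :
    -(((⨅ x ∈ interior A, ENNReal.ofReal (c * |x| ^ r)) : ℝ≥0∞) : EReal) ≤
      liminf (fun n : ℕ => ((((n : ℝ) ^ s)⁻¹ : ℝ) : EReal) * ENNReal.log (μ n A)) atTop := by
  refine le_of_forall_lt fun b hb => ?_
  obtain ⟨κ, hκ, hκb⟩ := EReal.lt_iff_exists_real_btwn.1 (EReal.lt_neg_comm.1 hb)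
  have hκ0 : 0 < κ := EReal.coe_pos.1 ((EReal.coe_ennreal_nonneg _).trans_lt hκ)
  have e : (κ : EReal) = ((ENNReal.ofReal κ : ℝ≥0∞) : EReal) := by
    rw [EReal.coe_ennreal_ofReal, max_eq_left hκ0.le]
  rw [e, EReal.coe_ennreal_lt_coe_ennreal_iff, iInf_lt_iff] at hκ
  obtain ⟨x, hx⟩ := hκ
  obtain ⟨hxA, hx⟩ := iInf_lt_iff.1 hx
  rw [ENNReal.ofReal_lt_ofReal_iff hκ0] at hx
  have hcont : Continuous fun x : ℝ => c * |x| ^ r :=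
    continuous_const.mul (continuous_abs.rpow_const fun _ => Or.inr hr.le)
  obtain ⟨w, ⟨hwA, hw⟩, hw0⟩ := (dense_compl_singleton (0 : ℝ)).inter_open_nonempty
    (interior A ∩ {x | c * |x| ^ r < κ})
    (isOpen_interior.inter (isOpen_lt hcont continuous_const)) ⟨x, hxA, hx⟩
  obtain ⟨η, hη, hball⟩ := Metric.isOpen_iff.1 isOpen_interior w hwA
  refine (EReal.lt_neg_comm.1 hκb).trans_le ?_
  refine le_liminf_of_le (by isBoundedDefault) ?_
  filter_upwards [hlow w hw0 η hη κ hw, eventually_gt_atTop 0] with n hn hn0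
  have hS : 0 < (n : ℝ) ^ s := Real.rpow_pos_of_pos (by exact_mod_cast hn0) s
  exact neg_le_inv_mul_log hS (hn.trans (measure_mono fun t ht => interior_subset (hball ht)))

theorem ldp_upper_bound (hc : 0 < c) (hr : 0 < r) (hμ : ∀ᶠ n in atTop, μ n univ ≤ 1)
    (hup : ∀ w : ℝ, 0 < w → ExpDecay s (c * w ^ r) (fun n => μ n {t | w ≤ |t|})) (A : Set ℝ) :
    limsup (fun n : ℕ => ((((n : ℝ) ^ s)⁻¹ : ℝ) : EReal) * ENNReal.log (μ n A)) atTop ≤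
      -(((⨅ x ∈ closure A, ENNReal.ofReal (c * |x| ^ r)) : ℝ≥0∞) : EReal) := by
  refine le_of_forall_gt fun b hb => ?_
  obtain ⟨κ, hκb, hκ⟩ := EReal.lt_iff_exists_real_btwn.1 (EReal.neg_lt_comm.1 hb)
  refine lt_of_le_of_lt ?_ (EReal.neg_lt_comm.1 hκb)
  suffices h : ∀ᶠ n : ℕ in atTop, μ n A ≤ ENNReal.ofReal (Real.exp (-(κ * (n : ℝ) ^ s))) by
    refine limsup_le_of_le (by isBoundedDefault) ?_
    filter_upwards [h, eventually_gt_atTop 0] with n hn hn0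
    exact inv_mul_log_le_neg (Real.rpow_pos_of_pos (by exact_mod_cast hn0) s) hn
  rcases le_or_gt κ 0 with hκ0 | hκ0
  · filter_upwards [hμ] with n hn
    refine ((measure_mono (subset_univ A)).trans hn).trans (ENNReal.one_le_ofReal.2 ?_)
    rw [Real.one_le_exp_iff, Left.nonneg_neg_iff]
    exact mul_nonpos_of_nonpos_of_nonneg hκ0 (by positivity)
  · obtain ⟨κ₁, hκ₁, hκ₁'⟩ := EReal.lt_iff_exists_real_btwn.1 hκ
    have hκ₁ : κ < κ₁ := EReal.coe_lt_coe_iff.1 hκ₁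
    have hκ₁0 : 0 < κ₁ := hκ0.trans hκ₁
    have e : (κ₁ : EReal) = ((ENNReal.ofReal κ₁ : ℝ≥0∞) : EReal) := by
      rw [EReal.coe_ennreal_ofReal, max_eq_left hκ₁0.le]
    rw [e, EReal.coe_ennreal_lt_coe_ennreal_iff] at hκ₁'
    have hw : 0 < (κ₁ / c) ^ (1 / r) := by positivity
    have hwr : c * ((κ₁ / c) ^ (1 / r)) ^ r = κ₁ := by
      rw [← Real.rpow_mul (by positivity), one_div_mul_cancel hr.ne', Real.rpow_one]
      field_simp
    have h := hup _ hw κ (by rwa [hwr])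
    filter_upwards [h] with n hn
    refine (measure_mono fun x hx => ?_).trans hn
    have hlt := hκ₁'.trans_le (iInf₂_le x (subset_closure hx))
    by_contra hcon
    rw [mem_ofPred_eq, not_le] at hcon
    have : c * |x| ^ r ≤ κ₁ := by rw [← hwr]; gcongr
    exact hlt.not_ge (ENNReal.ofReal_le_ofReal this)

end LDP

/-- Gantert–Kim–Ramanan LDP for one-dimensional random projections of `ℓ_p^n`-balls in
the case `1 ≤ p < 2`: with `X^{(n)} ~ ν_p^n` (or `~ μ_p^n`) and `Θ^{(n)}` uniform on
the Euclidean unit sphere, independent of `X^{(n)}`, the sequence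
`W_n = n^{1/p−1/2} ⟨X^{(n)}, Θ^{(n)}⟩` satisfies an LDP with speed `n^{2p/(2+p)}` and
good rate function `I(w) = ((2+p)/(2p)) |w|^{2p/(2+p)}`. -/
theorem ldp_random_projection_lp_ball (p : ℝ) (hp : 1 ≤ p) (hp2 : p < 2)
    (μX : (n : ℕ) → Measure (EuclideanSpace ℝ (Fin n)))
    (hμX : (∀ n, μX n = nuMeasure n p) ∨ (∀ n, IsConeMeasure n p (μX n))) :
    IsLDP
      (fun n => Measure.map
        (fun z : EuclideanSpace ℝ (Fin n) × EuclideanSpace ℝ (Fin n) =>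
          (n : ℝ) ^ (1 / p - 1 / 2) * ∑ i, z.1 i * z.2 i)
        ((μX n).prod (sphereUniform n)))
      (fun n => (n : ℝ) ^ (2 * p / (2 + p)))
      (fun w => ENNReal.ofReal ((2 + p) / (2 * p) * |w| ^ (2 * p / (2 + p)))) := by
  have hp0 : 0 < p := by linarith
  have hr : 0 < 2 * p / (2 + p) := by positivity
  have hc : 0 < (2 + p) / (2 * p) := by positivity
  have hμ : ∀ n, μX n = nuMeasure n p ∨ IsConeMeasure n p (μX n) := fun n =>
    hμX.imp (fun h => h n) fun h => h n
  refine ⟨isCompact_powerRate_le hc hr, fun A _ => ⟨?_, ?_⟩⟩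
  · exact ldp_lower_bound hr
      (fun w hw η hη κ hκ => eventually_projStat_near_ge hp hp2 hμ hw hη hκ) A
  · refine ldp_upper_bound hc hr ?_ (fun w hw => expDecay_projStat hp hp2 hμ hw) A
    have := isProbabilityMeasure_pairLaw hp0
    filter_upwards [eventually_gt_atTop 0] with n hn
    have h := map_projStat_ge_le hn hp0 (hμ n) 0
    simp only [abs_nonneg, ofPred_true, measure_univ] at h
    exact h
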